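/- Let d ≥ 1, 2 ≤ p < ∞ and r ≥ 0. There is a constant C (depending only on d, p, r) such that for all n ∈ ℕ and all 1 ≤ m ≤ |Q_n|, the Kolmogorov numbers of the dyadic hyperbolic layer projection on the Sobolev space of mixed smoothness satisfy d_m(S_{ΔQ_n} : W^r_p(𝕋^d) → L_∞(𝕋^d)) ≤ C 2^{−rn} (2^n/m)^{1/p} n^{(d−1)(1−1/p) + 1/p}. -/

import Mathlib

open MeasureTheory Real
open scoped ENNReal ComplexConjugate Classical

noncomputable section

instance : Fact (0 < 2 * π) := ⟨by positivity⟩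

/-- The `d`-dimensional torus `[0, 2π]^d`. -/
abbrev Torus (d : ℕ) := Fin d → AddCircle (2 * π)

/-- The multivariate trigonometric character `x ↦ e^{i k · x}`. -/
def trigChar {d : ℕ} (k : Fin d → ℤ) : C(Torus d, ℂ) :=
  ⟨fun x => ∏ j, fourier (k j) (x j),
    continuous_finset_prod _ fun j _ => (map_continuous (fourier (k j))).comp (continuous_apply j)⟩

/-- The Fourier coefficient `f̂(k) = (2π)^{-d} ∫ f(x) e^{-i k·x} dx`. -/
def fCoeff {d : ℕ} (f : Torus d → ℂ) (k : Fin d → ℤ) : ℂ :=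
  ((2 * π) ^ d)⁻¹ • ∫ x : Torus d, conj (trigChar k x) * f x

/-- A continuous function on the torus, considered as an element of `L_∞`. -/
def toLinfty {d : ℕ} (g : C(Torus d, ℂ)) : Lp ℂ ∞ (volume : Measure (Torus d)) :=
  ContinuousMap.toLp ∞ (volume : Measure (Torus d)) ℂ g

/-- The dyadic block `ρ(s) = {k : ⌊2^{s_j - 1}⌋ ≤ |k_j| < 2^{s_j}, j = 1,…,d}`. -/
def inRho {d : ℕ} (s : Fin d → ℕ) (k : Fin d → ℤ) : Prop :=
  ∀ j, (2 ^ (s j) / 2 : ℤ) ≤ |k j| ∧ |k j| < 2 ^ (s j)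

/-- The step hyperbolic cross `Q_n = ⋃_{‖s‖₁ ≤ n} ρ(s)` as a finite set of frequencies. -/
def hypCross (d n : ℕ) : Finset (Fin d → ℤ) :=
  (Finset.Icc (fun _ => -(2 ^ n : ℤ)) fun _ => (2 ^ n : ℤ)).filter
    fun k => ∃ s : Fin d → ℕ, (∑ j, s j) ≤ n ∧ inRho s k

/-- The Fourier coefficients `F̂_{r,0}(k) = ∏_j |k_j|^{-r}` (with the convention
`|0|^{-r} = 1`) of the multivariate Bernoulli kernel `F_{r,α}` for `α = 0`. -/
def wBern (d : ℕ) (r : ℝ) (k : Fin d → ℤ) : ℝ :=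
  ∏ j, if k j = 0 then 1 else |(k j : ℝ)| ^ (-r)

/-- The operator `S_{ΔQ_n} = S_{Q_n} - S_{Q_{n-1}} : W^r_p(𝕋^d) → L_∞(𝕋^d)` (for `n ≥ 1`),
realized through the isometric parametrization `W^r_p ∋ f = F_{r,0} ∗ φ ↔ φ ∈ L_p`,
`‖f‖_{W^r_p} = ‖φ‖_p`: since `(F_{r,0} ∗ φ)^(k) = F̂_{r,0}(k) φ̂(k)`, the operator sends
`φ ↦ ∑_{k ∈ Q_n \ Q_{n-1}} F̂_{r,0}(k) φ̂(k) e^{i k·x}`. -/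
def SDeltaW (d : ℕ) (r : ℝ) (q : ℝ≥0∞) (n : ℕ)
    (φ : Lp ℂ q (volume : Measure (Torus d))) : Lp ℂ ∞ (volume : Measure (Torus d)) :=
  toLinfty (∑ k ∈ hypCross d n \ hypCross d (n - 1),
    ((wBern d r k : ℂ) * fCoeff (φ : Torus d → ℂ) k) • trigChar k)

/-- Kolmogorov numbers. -/
noncomputable def dK {A B : Type*} [Norm A] [NormedAddCommGroup B] [NormedSpace ℂ B]
    (T : A → B) (m : ℕ) : ℝ :=
  ⨅ L : {L : Submodule ℂ B // FiniteDimensional ℂ L ∧ Module.finrank ℂ L < m},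
    ⨆ a : {a : A // ‖a‖ ≤ 1}, ⨅ b : L.1, ‖T a.1 - (b : B)‖

/-- The sign `±1` attached to a Boolean. -/
def boolSign (b : Bool) : ℝ := if b then 1 else -1

lemma boolSign_mul_self (b : Bool) : boolSign b * boolSign b = 1 := by
  cases b <;> simp [boolSign]

lemma integral_exp_linear_sub_sq (A : ℝ) :
    ∫ g : ℝ, exp (A * g - g ^ 2) = exp (A ^ 2 / 4) * √π := by
  have h : ∀ g : ℝ, exp (A * g - g ^ 2) = exp (A ^ 2 / 4) * exp (-1 * (g - A / 2) ^ 2) := by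
    intro g
    rw [← Real.exp_add]
    ring_nf
  simp_rw [h]
  rw [integral_const_mul, integral_sub_right_eq_self (fun x : ℝ => exp (-1 * x ^ 2)),
    integral_gaussian, div_one]

lemma integrable_exp_linear_sub_sq (A : ℝ) : Integrable fun g : ℝ => exp (A * g - g ^ 2) := by
  have h : ∀ g : ℝ, exp (A * g - g ^ 2) = exp (A ^ 2 / 4) * exp (-1 * (g - A / 2) ^ 2) := by
    intro g
    rw [← Real.exp_add]
    ring_nf
  simp_rw [h]
  exact ((integrable_exp_neg_mul_sq one_pos).comp_sub_right (A / 2)).const_mul _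

section Signs

variable {κ : Type*} [Fintype κ]

lemma sum_signs_exp (a : κ → ℝ) (y : ℝ) :
    ∑ ε : κ → Bool, exp ((∑ k, a k * boolSign (ε k)) * y) = ∏ k, (2 * cosh (a k * y)) := by
  have h : ∀ k, 2 * cosh (a k * y) = ∑ b : Bool, exp (a k * boolSign b * y) := by
    intro k
    rw [Fintype.sum_bool, Real.cosh_eq]
    simp [boolSign]
    ring
  simp_rw [h, Finset.prod_univ_sum, Fintype.piFinset_univ, Finset.sum_mul, Real.exp_sum]

/-- Rademacher sums have square-exponential moments. -/
lemma sum_signs_exp_sq (a : κ → ℝ) (ha : ∑ k, a k ^ 2 ≤ 1) :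
    ∑ ε : κ → Bool, exp ((∑ k, a k * boolSign (ε k)) ^ 2 / 4) ≤ √2 * 2 ^ Fintype.card κ := by
  have hπ : 0 < √π := Real.sqrt_pos.2 Real.pi_pos
  refine le_of_mul_le_mul_right ?_ hπ
  rw [Finset.sum_mul]
  simp_rw [← integral_exp_linear_sub_sq]
  rw [← integral_finsetSum _ fun ε _ => integrable_exp_linear_sub_sq _]
  have hb : ∀ g : ℝ, ∑ ε : κ → Bool, exp ((∑ k, a k * boolSign (ε k)) * g - g ^ 2)
      ≤ 2 ^ Fintype.card κ * exp (-(1 / 2) * g ^ 2) := by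
    intro g
    simp_rw [Real.exp_sub, ← Finset.sum_div, sum_signs_exp]
    rw [div_le_iff₀ (Real.exp_pos _)]
    calc ∏ k, (2 * cosh (a k * g)) ≤ ∏ k, (2 * exp ((a k * g) ^ 2 / 2)) := by
          refine Finset.prod_le_prod (fun k _ => by positivity) fun k _ => ?_
          gcongr
          exact Real.cosh_le_exp_half_sq _
      _ = 2 ^ Fintype.card κ * exp ((∑ k, a k ^ 2) * (g ^ 2 / 2)) := by
          rw [Finset.prod_mul_distrib, ← Real.exp_sum, Finset.prod_const, Finset.card_univ,
            Finset.sum_mul]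
          congr 2
          refine Finset.sum_congr rfl fun k _ => by ring
      _ ≤ 2 ^ Fintype.card κ * exp (1 * (g ^ 2 / 2)) := by gcongr
      _ = 2 ^ Fintype.card κ * exp (-(1 / 2) * g ^ 2) * exp (g ^ 2) := by
          rw [mul_assoc, ← Real.exp_add]
          ring_nf
  calc ∫ g : ℝ, ∑ ε : κ → Bool, exp ((∑ k, a k * boolSign (ε k)) * g - g ^ 2)
      ≤ ∫ g : ℝ, 2 ^ Fintype.card κ * exp (-(1 / 2) * g ^ 2) := by
        refine integral_mono (integrable_finsetSum _ fun ε _ => integrable_exp_linear_sub_sq _)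
          ((integrable_exp_neg_mul_sq (by norm_num)).const_mul _) hb
    _ = √2 * 2 ^ Fintype.card κ * √π := by
        rw [integral_const_mul, integral_gaussian]
        have : π / (1 / 2) = 2 * π := by ring
        rw [this, Real.sqrt_mul (by norm_num)]
        ring

/-- The squared modulus of a Rademacher sum. -/
def signSq (v : κ → ℂ) (ε : κ → Bool) : ℝ := ‖∑ k, v k * (boolSign (ε k) : ℂ)‖ ^ 2

lemma signSq_nonneg (v : κ → ℂ) (ε : κ → Bool) : 0 ≤ signSq v ε := by
  unfold signSq; positivity

lemma signSq_eq (v : κ → ℂ) (ε : κ → Bool) : signSq v ε =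
    (∑ k, (v k).re * boolSign (ε k)) ^ 2 + (∑ k, (v k).im * boolSign (ε k)) ^ 2 := by
  rw [signSq, ← Complex.normSq_eq_norm_sq, Complex.normSq_apply]
  simp [pow_two]

lemma sum_signSq_exp (v : κ → ℂ) (hv : ∑ k, ‖v k‖ ^ 2 ≤ 1) :
    ∑ ε : κ → Bool, exp (signSq v ε / 8) ≤ √2 * 2 ^ Fintype.card κ := by
  have hre : ∑ k, (v k).re ^ 2 ≤ 1 := le_trans (Finset.sum_le_sum fun k _ => by
    rw [← Complex.normSq_eq_norm_sq, Complex.normSq_apply]; nlinarith [sq_nonneg (v k).im]) hv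
  have him : ∑ k, (v k).im ^ 2 ≤ 1 := le_trans (Finset.sum_le_sum fun k _ => by
    rw [← Complex.normSq_eq_norm_sq, Complex.normSq_apply]; nlinarith [sq_nonneg (v k).re]) hv
  have h1 := sum_signs_exp_sq _ hre
  have h2 := sum_signs_exp_sq _ him
  have h : ∀ ε : κ → Bool, exp (signSq v ε / 8) ≤
      exp ((∑ k, (v k).re * boolSign (ε k)) ^ 2 / 4) / 2 +
        exp ((∑ k, (v k).im * boolSign (ε k)) ^ 2 / 4) / 2 := by
    intro ε
    rw [signSq_eq]
    set A := (∑ k, (v k).re * boolSign (ε k)) ^ 2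
    set B := (∑ k, (v k).im * boolSign (ε k)) ^ 2
    have e : exp ((A + B) / 8) = exp (A / 8) * exp (B / 8) := by rw [← Real.exp_add]; ring_nf
    have eA : exp (A / 4) = exp (A / 8) ^ 2 := by rw [← Real.exp_nat_mul]; ring_nf
    have eB : exp (B / 4) = exp (B / 8) ^ 2 := by rw [← Real.exp_nat_mul]; ring_nf
    rw [e, eA, eB]
    nlinarith [sq_nonneg (exp (A / 8) - exp (B / 8))]
  refine (Finset.sum_le_sum fun ε _ => h ε).trans ?_
  rw [Finset.sum_add_distrib, ← Finset.sum_div, ← Finset.sum_div]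
  linarith

lemma sum_signs_mul (j k : κ) : ∑ ε : κ → Bool, boolSign (ε j) * boolSign (ε k) =
    if j = k then 2 ^ Fintype.card κ else 0 := by
  split_ifs with h
  · subst h
    simp [boolSign_mul_self]
  · have hinv : Function.Involutive fun ε : κ → Bool => Function.update ε j (!ε j) := by
      intro ε
      ext i
      by_cases hi : i = j
      · subst hi; simp
      · simp [hi]
    have := Equiv.sum_comp (hinv.toPerm _) fun ε : κ → Bool => boolSign (ε j) * boolSign (ε k)
    have h2 : ∀ ε : κ → Bool, boolSign (hinv.toPerm _ ε j) * boolSign (hinv.toPerm _ ε k) =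
        -(boolSign (ε j) * boolSign (ε k)) := by
      intro ε
      simp only [Function.Involutive.coe_toPerm, Function.update_self,
        Function.update_of_ne (Ne.symm h)]
      cases ε j <;> cases ε k <;> simp [boolSign]
    simp_rw [h2, Finset.sum_neg_distrib] at this
    linarith

lemma sum_signs_sq (a : κ → ℝ) : ∑ ε : κ → Bool, (∑ k, a k * boolSign (ε k)) ^ 2 =
    2 ^ Fintype.card κ * ∑ k, a k ^ 2 := by
  simp_rw [pow_two, Finset.sum_mul_sum]
  rw [Finset.sum_comm]
  simp_rw [Finset.sum_comm (s := (Finset.univ : Finset (κ → Bool)))]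
  have : ∀ j k, ∑ ε : κ → Bool, a j * boolSign (ε j) * (a k * boolSign (ε k)) =
      if j = k then a j * a k * 2 ^ Fintype.card κ else 0 := by
    intro j k
    rw [← mul_ite_zero, ← sum_signs_mul, Finset.mul_sum]
    exact Finset.sum_congr rfl fun ε _ => by ring
  simp_rw [this]
  simp [Finset.mul_sum, mul_comm]

lemma sum_signSq (v : κ → ℂ) :
    ∑ ε : κ → Bool, signSq v ε = 2 ^ Fintype.card κ * ∑ k, ‖v k‖ ^ 2 := by
  simp_rw [signSq_eq, Finset.sum_add_distrib, sum_signs_sq, ← mul_add, ← Finset.sum_add_distrib]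
  congr 1
  refine Finset.sum_congr rfl fun k _ => ?_
  rw [← Complex.normSq_eq_norm_sq, Complex.normSq_apply]; ring

lemma exp_neg_le_quadratic {x : ℝ} (hx : 0 ≤ x) : exp (-x) ≤ 1 - x + x ^ 2 / 2 := by
  have h := Real.quadratic_le_exp_of_nonneg hx
  have h2 : 0 < 1 - x + x ^ 2 / 2 := by nlinarith [sq_nonneg (x - 1)]
  rw [Real.exp_neg]
  refine (inv_anti₀ (by positivity) h).trans ?_
  rw [inv_le_iff_one_le_mul₀ (by positivity)]
  nlinarith [sq_nonneg (x ^ 2)]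

lemma sqrt_two_lt : √2 < 1.42 := by
  rw [Real.sqrt_lt' (by norm_num)]; norm_num

lemma sum_signSq_exp_neg (v : κ → ℂ) (hv : ∑ k, ‖v k‖ ^ 2 = 1) :
    ∑ ε : κ → Bool, exp (-(signSq v ε / 182)) ≤ exp (-(1 / 364)) * 2 ^ Fintype.card κ := by
  have h4 : ∀ ε : κ → Bool, signSq v ε ^ 2 ≤ 128 * exp (signSq v ε / 8) := by
    intro ε
    have := Real.quadratic_le_exp_of_nonneg (x := signSq v ε / 8)
      (by have := signSq_nonneg v ε; positivity)
    nlinarith [signSq_nonneg v ε]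
  have h := sum_signSq_exp v hv.le
  have h1 := sum_signSq v
  rw [hv, mul_one] at h1
  have hb : ∀ ε : κ → Bool, exp (-(signSq v ε / 182)) ≤
      1 - signSq v ε / 182 + (128 * exp (signSq v ε / 8)) / (182 ^ 2 * 2) := by
    intro ε
    refine (exp_neg_le_quadratic (by have := signSq_nonneg v ε; positivity)).trans ?_
    have := h4 ε
    have : signSq v ε ^ 2 / (182 ^ 2 * 2) ≤ (128 * exp (signSq v ε / 8)) / (182 ^ 2 * 2) := by
      gcongr
    have e : (signSq v ε / 182) ^ 2 / 2 = signSq v ε ^ 2 / (182 ^ 2 * 2) := by ring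
    rw [e]; linarith
  refine (Finset.sum_le_sum fun ε _ => hb ε).trans ?_
  rw [Finset.sum_add_distrib, Finset.sum_sub_distrib, ← Finset.sum_div, ← Finset.sum_div, h1,
    ← Finset.mul_sum]
  simp only [Finset.sum_const, Finset.card_univ, Fintype.card_fun, Fintype.card_bool, nsmul_eq_mul,
    mul_one, Nat.cast_pow, Nat.cast_ofNat]
  have h5 : (1 : ℝ) - 1 / 364 ≤ exp (-(1 / 364)) := by
    have := Real.add_one_le_exp (-(1 / 364) : ℝ); linarith
  have hp : (0 : ℝ) < 2 ^ Fintype.card κ := by positivity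
  have h6 : √2 * 2 ^ Fintype.card κ ≤ 1.42 * 2 ^ Fintype.card κ := by
    gcongr; exact sqrt_two_lt.le
  have h7 : (1 - 1 / 364 : ℝ) * 2 ^ Fintype.card κ ≤ exp (-(1 / 364)) * 2 ^ Fintype.card κ := by
    gcongr
  set X := ∑ ε : κ → Bool, exp (signSq v ε / 8)
  have h8 : X ≤ 1.42 * 2 ^ Fintype.card κ := h.trans h6
  refine le_trans ?_ h7
  linarith

/-- A random sign matrix is simultaneously bounded on one family of vectors and bounded below
on another one. -/
lemma exists_sign_matrix {Ω₁ Ω₂ : Type*} [Fintype Ω₁] [Fintype Ω₂] (m : ℕ) (v : Ω₁ → κ → ℂ)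
    (u : Ω₂ → κ → ℂ)
    (hcard : Fintype.card Ω₁ * exp (-(m / 728 : ℝ)) + Fintype.card Ω₂ * exp (-(m : ℝ)) < 1) :
    ∃ G : Fin m → κ → Bool,
      (∀ ω, (m / 4 : ℝ) * ∑ k, ‖v ω k‖ ^ 2 ≤ ∑ j, signSq (v ω) (G j)) ∧
      (∀ ω, ∑ j, signSq (u ω) (G j) ≤ 16 * m * ∑ k, ‖u ω k‖ ^ 2) := by
  have scale : ∀ (w : κ → ℂ), (∃ k, w k ≠ 0) → ∃ w' : κ → ℂ, ∑ k, ‖w' k‖ ^ 2 = 1 ∧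
      ∀ ε, signSq w ε = (∑ k, ‖w k‖ ^ 2) * signSq w' ε := by
    rintro w ⟨k₀, hk₀⟩
    have hpos : 0 < ∑ k, ‖w k‖ ^ 2 :=
      Finset.sum_pos' (fun k _ => by positivity) ⟨k₀, Finset.mem_univ _, by positivity⟩
    have hs : √(∑ k, ‖w k‖ ^ 2) ^ 2 = ∑ k, ‖w k‖ ^ 2 := Real.sq_sqrt hpos.le
    set N := √(∑ k, ‖w k‖ ^ 2) with hN
    have hN0 : N ≠ 0 := by rw [hN]; positivity
    refine ⟨fun k => ((N⁻¹ : ℝ) : ℂ) * w k, ?_, fun ε => ?_⟩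
    · simp only [norm_mul, mul_pow, ← Finset.mul_sum, Complex.norm_real, Real.norm_eq_abs, sq_abs]
      rw [← hs]; field_simp
    · rw [← hs]
      simp only [signSq, mul_assoc, ← Finset.mul_sum, norm_mul, mul_pow, Complex.norm_real,
        Real.norm_eq_abs, sq_abs]
      field_simp
  have zero : ∀ (w : κ → ℂ), ¬(∃ k, w k ≠ 0) → ∀ ε, signSq w ε = 0 ∧ ∑ k, ‖w k‖ ^ 2 = 0 := by
    intro w hw ε
    push Not at hw
    simp [signSq, hw]
  have pow_sum : ∀ f : (κ → Bool) → ℝ, ∑ G : Fin m → κ → Bool, exp (∑ j, f (G j)) =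
      (∑ ε, exp (f ε)) ^ m := by
    intro f
    simp_rw [Real.exp_sum, Fintype.sum_pow]
  have key : ∀ (w : κ → ℂ), ∃ Φ Ψ : (Fin m → κ → Bool) → ℝ,
      (∀ G, 0 ≤ Φ G ∧ 0 ≤ Ψ G) ∧
      (∑ G, Φ G ≤ exp (-(m / 728 : ℝ)) * 2 ^ (Fintype.card κ * m)) ∧
      (∑ G, Ψ G ≤ exp (-(m : ℝ)) * 2 ^ (Fintype.card κ * m)) ∧
      (∀ G, Φ G < 1 → (m / 4 : ℝ) * ∑ k, ‖w k‖ ^ 2 ≤ ∑ j, signSq w (G j)) ∧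
      (∀ G, Ψ G < 1 → ∑ j, signSq w (G j) ≤ 16 * m * ∑ k, ‖w k‖ ^ 2) := by
    intro w
    by_cases hw : ∃ k, w k ≠ 0
    · obtain ⟨w', hw1, hw2⟩ := scale w hw
      have hN : 0 ≤ ∑ k, ‖w k‖ ^ 2 := Finset.sum_nonneg fun k _ => by positivity
      refine ⟨fun G => exp (m / 728) * exp (∑ j, -(signSq w' (G j) / 182)),
        fun G => exp (-(2 * m)) * exp (∑ j, signSq w' (G j) / 8),
        fun G => ⟨by positivity, by positivity⟩, ?_, ?_, ?_, ?_⟩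
      · rw [← Finset.mul_sum, pow_sum (fun ε => -(signSq w' ε / 182))]
        calc _ ≤ exp (m / 728) * (exp (-(1 / 364)) * 2 ^ Fintype.card κ) ^ m := by
              gcongr
              exact sum_signSq_exp_neg w' hw1
          _ = _ := by
              rw [mul_pow, ← mul_assoc, ← Real.exp_nat_mul, ← Real.exp_add, pow_mul]
              ring_nf
      · rw [← Finset.mul_sum, pow_sum (fun ε => signSq w' ε / 8)]
        calc _ ≤ exp (-(2 * m)) * (exp 1 * 2 ^ Fintype.card κ) ^ m := by
              gcongr
              refine (sum_signSq_exp w' hw1.le).trans ?_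
              gcongr
              have := Real.add_one_le_exp (1 : ℝ)
              have := sqrt_two_lt
              linarith
          _ = _ := by
              rw [mul_pow, ← mul_assoc, ← Real.exp_nat_mul, ← Real.exp_add, pow_mul]
              ring_nf
      · intro G hG
        simp only at hG
        rw [← Real.exp_add, Real.exp_lt_one_iff, Finset.sum_neg_distrib, ← Finset.sum_div] at hG
        simp_rw [hw2]
        rw [← Finset.mul_sum, mul_comm]
        gcongr
        linarith
      · intro G hG
        simp only at hG
        rw [← Real.exp_add, Real.exp_lt_one_iff, ← Finset.sum_div] at hG
        simp_rw [hw2]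
        rw [← Finset.mul_sum, mul_comm]
        gcongr
        linarith
    · refine ⟨0, 0, by simp, ?_, ?_, ?_, ?_⟩
      · simp; positivity
      · simp; positivity
      · intro G _
        simp [(zero w hw (fun _ => true)).2, (zero w hw _).1]
      · intro G _
        simp [(zero w hw (fun _ => true)).2, (zero w hw _).1]
  choose Φ Ψ h0 hΦ hΨ hΦ1 hΨ1 using key
  have htot : ∑ G : Fin m → κ → Bool, (∑ ω, Φ (v ω) G + ∑ ω, Ψ (u ω) G) <
      ∑ G : Fin m → κ → Bool, (1 : ℝ) := by
    rw [Finset.sum_add_distrib, Finset.sum_comm (f := fun G ω => Φ (v ω) G),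
      Finset.sum_comm (f := fun G ω => Ψ (u ω) G)]
    have e : ∑ G : Fin m → κ → Bool, (1 : ℝ) = 2 ^ (Fintype.card κ * m) := by
      simp [pow_mul]
    rw [e]
    calc _ ≤ ∑ ω : Ω₁, exp (-(m / 728 : ℝ)) * 2 ^ (Fintype.card κ * m) +
          ∑ ω : Ω₂, exp (-(m : ℝ)) * 2 ^ (Fintype.card κ * m) :=
          add_le_add (Finset.sum_le_sum fun ω _ => hΦ _) (Finset.sum_le_sum fun ω _ => hΨ _)
      _ = (Fintype.card Ω₁ * exp (-(m / 728 : ℝ)) + Fintype.card Ω₂ * exp (-(m : ℝ))) *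
          2 ^ (Fintype.card κ * m) := by
          simp only [Finset.sum_const, Finset.card_univ, nsmul_eq_mul]; ring
      _ < 1 * 2 ^ (Fintype.card κ * m) := by gcongr
      _ = _ := one_mul _
  obtain ⟨G, _, hG⟩ := Finset.exists_lt_of_sum_lt htot
  have n1 : 0 ≤ ∑ ω, Φ (v ω) G := Finset.sum_nonneg fun ω _ => (h0 _ G).1
  have n2 : 0 ≤ ∑ ω, Ψ (u ω) G := Finset.sum_nonneg fun ω _ => (h0 _ G).2
  refine ⟨G, fun ω => hΦ1 _ _ ?_, fun ω => hΨ1 _ _ ?_⟩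
  · have := Finset.single_le_sum (f := fun ω => Φ (v ω) G) (fun ω _ => (h0 _ G).1)
      (Finset.mem_univ ω)
    linarith
  · have := Finset.single_le_sum (f := fun ω => Ψ (u ω) G) (fun ω _ => (h0 _ G).2)
      (Finset.mem_univ ω)
    linarith

end Signs

/-- Maurey's empirical method: a convex combination is close to an average of few vectors. -/
lemma exists_maurey_average {H Ω : Type*} [NormedAddCommGroup H] [InnerProductSpace ℂ H]
    [Fintype Ω] (p : Ω → ℝ) (hp : ∀ ω, 0 ≤ p ω) (hp1 : ∑ ω, p ω = 1) (w : Ω → H) {R : ℝ}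
    (hR : ∀ ω, ‖w ω‖ ≤ R) (s : ℕ) :
    ∃ f : Fin s → Ω,
      ‖∑ j, w (f j) - (s : ℂ) • ∑ ω, (p ω : ℂ) • w ω‖ ^ 2 ≤ s * (2 * R) ^ 2 := by
  set a := ∑ ω, (p ω : ℂ) • w ω with ha
  have haR : ‖a‖ ≤ R := by
    calc ‖a‖ ≤ ∑ ω, p ω * R := norm_sum_le_of_le _ fun ω _ => by
          rw [norm_smul, Complex.norm_real, Real.norm_of_nonneg (hp ω)]
          exact mul_le_mul_of_nonneg_left (hR ω) (hp ω)
      _ = R := by rw [← Finset.sum_mul, hp1, one_mul]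
  induction s with
  | zero => exact ⟨Fin.elim0, by simp⟩
  | succ s ih =>
    obtain ⟨f, hf⟩ := ih
    set x := ∑ j, w (f j) - (s : ℂ) • a with hx
    have hzero : ∑ ω, p ω * RCLike.re (inner ℂ x (w ω - a)) = 0 := by
      have h1 : ∀ ω, p ω * RCLike.re (inner ℂ x (w ω - a)) =
          RCLike.re (inner ℂ x ((p ω : ℂ) • w ω - (p ω : ℂ) • a)) := by
        intro ω
        rw [← smul_sub, inner_smul_right]
        exact (Complex.re_ofReal_mul _ _).symm
      simp_rw [h1]
      rw [← map_sum, ← inner_sum, Finset.sum_sub_distrib, ← Finset.sum_smul, ← Complex.ofReal_sum,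
        hp1, Complex.ofReal_one, one_smul, ← ha, sub_self, inner_zero_right, map_zero]
    obtain ⟨ω, hω⟩ : ∃ ω, RCLike.re (inner ℂ x (w ω - a)) ≤ 0 := by
      by_contra! hcon
      have hall : ∀ ω ∈ Finset.univ, p ω * RCLike.re (inner ℂ x (w ω - a)) = 0 :=
        (Finset.sum_eq_zero_iff_of_nonneg fun ω _ => mul_nonneg (hp ω) (hcon ω).le).1 hzero
      have hp0 : ∀ ω, p ω = 0 := fun ω =>
        (mul_eq_zero.1 (hall ω (Finset.mem_univ ω))).resolve_right (hcon ω).ne'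
      simp [hp0] at hp1
    refine ⟨Fin.snoc f ω, ?_⟩
    have e : ∑ j, w ((Fin.snoc f ω : Fin (s + 1) → Ω) j) - ((s + 1 : ℕ) : ℂ) • a =
        x + (w ω - a) := by
      rw [Fin.sum_univ_castSucc]
      simp only [Fin.snoc_castSucc, Fin.snoc_last, hx]
      push_cast
      rw [add_smul, one_smul]
      abel
    rw [e, norm_add_sq (𝕜 := ℂ)]
    have hn : ‖w ω - a‖ ≤ 2 * R := (norm_sub_le _ _).trans (by linarith [hR ω])
    have hn2 : ‖w ω - a‖ ^ 2 ≤ (2 * R) ^ 2 := by gcongr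
    push_cast
    linarith

/-- Distance to a subspace in the maximum norm, by duality. -/
lemma exists_near_of_annihilator {ι : Type*} [Fintype ι] (L : Submodule ℂ (ι → ℂ)) (y : ι → ℂ)
    {D : ℝ} (hD : ∀ μ : ι → ℂ, ∑ i, ‖μ i‖ ≤ 1 → (∀ l ∈ L, ∑ i, μ i * l i = 0) →
      ‖∑ i, μ i * y i‖ ≤ D) :
    ∃ l ∈ L, ‖y - l‖ ≤ D := by
  obtain ⟨g, hg1, hg2⟩ := exists_dual_vector'' ℂ (L.mkQ y)
  have hgmk : ∀ z : ι → ℂ, ‖g (L.mkQ z)‖ ≤ ‖z‖ := fun z =>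
    (g.le_opNorm _).trans ((mul_le_of_le_one_left (norm_nonneg _) hg1).trans
      (Submodule.Quotient.norm_mk_le L z))
  set μ : ι → ℂ := fun i => g (L.mkQ (Pi.single i 1)) with hμ
  have hrep : ∀ z : ι → ℂ, g (L.mkQ z) = ∑ i, μ i * z i := by
    intro z
    have hz : z = ∑ i, z i • (Pi.single i (1 : ℂ) : ι → ℂ) := by
      ext j; simp [Finset.sum_apply, Pi.single_apply]
    conv_lhs => rw [hz]
    simp only [map_sum, map_smul, smul_eq_mul, hμ]
    exact Finset.sum_congr rfl fun i _ => mul_comm _ _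
  have hμ1 : ∑ i, ‖μ i‖ ≤ 1 := by
    set z : ι → ℂ := fun i => conj (μ i) / ‖μ i‖ with hz
    have hz1 : ‖z‖ ≤ 1 := by
      rw [pi_norm_le_iff_of_nonneg zero_le_one]
      intro i
      simp only [hz, norm_div, RCLike.norm_conj, Complex.norm_real, norm_norm]
      exact div_self_le_one _
    have h2 : g (L.mkQ z) = ((∑ i, ‖μ i‖ : ℝ) : ℂ) := by
      rw [hrep, Complex.ofReal_sum]
      refine Finset.sum_congr rfl fun i _ => ?_
      by_cases h0 : μ i = 0
      · simp [h0]
      · have : (‖μ i‖ : ℂ) ≠ 0 := by simpa using h0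
        simp only [hz]
        rw [mul_div_assoc', Complex.mul_conj, Complex.normSq_eq_norm_sq]
        field_simp
        push_cast
        ring
    have h3 := hgmk z
    rw [h2, Complex.norm_real, Real.norm_of_nonneg (Finset.sum_nonneg fun i _ => norm_nonneg _)]
      at h3
    linarith
  have hann : ∀ l ∈ L, ∑ i, μ i * l i = 0 := by
    intro l hl
    rw [← hrep, Submodule.mkQ_apply, (Submodule.Quotient.mk_eq_zero L).2 hl, map_zero]
  have hy := hD μ hμ1 hann
  rw [← hrep, hg2, RCLike.norm_ofReal, abs_norm] at hy
  have hcl : IsClosed (L : Set (ι → ℂ)) := L.closed_of_finiteDimensional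
  obtain ⟨l, hl, hdist⟩ := hcl.exists_infDist_eq_dist ⟨0, L.zero_mem⟩ y
  refine ⟨l, hl, ?_⟩
  rw [← dist_eq_norm, ← hdist]
  exact (QuotientAddGroup.norm_mk (S := L.toAddSubgroup) y).symm.trans_le hy

/-- Every complex measure of mass at most one is twice a convex combination of unimodular point
masses with the four units, and zero. -/
lemma exists_convex_units {ι : Type*} [Fintype ι] (μ : ι → ℂ) (hμ : ∑ i, ‖μ i‖ ≤ 1) :
    ∃ p : Option (ι × Fin 4) → ℝ, (∀ ω, 0 ≤ p ω) ∧ ∑ ω, p ω = 1 ∧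
      ∀ i, μ i = 2 * ∑ u, (p (some (i, u)) : ℂ) * Complex.I ^ (u : ℕ) := by
  set q : ι × Fin 4 → ℝ := fun x =>
    ![max (μ x.1).re 0 / 2, max (μ x.1).im 0 / 2, max (-(μ x.1).re) 0 / 2,
      max (-(μ x.1).im) 0 / 2] x.2 with hq
  have hq0 : ∀ x, 0 ≤ q x := by
    rintro ⟨i, u⟩
    fin_cases u <;> simp [hq] <;> positivity
  have hm : ∀ a : ℝ, max a 0 / 2 + max (-a) 0 / 2 = |a| / 2 := by
    intro a
    rcases le_total 0 a with h | h
    · rw [max_eq_left h, max_eq_right (by linarith), abs_of_nonneg h]; ring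
    · rw [max_eq_right h, max_eq_left (by linarith), abs_of_nonpos h]; ring
  have hm' : ∀ a : ℝ, max a 0 - max (-a) 0 = a := by
    intro a
    rcases le_total 0 a with h | h
    · rw [max_eq_left h, max_eq_right (by linarith)]; ring
    · rw [max_eq_right h, max_eq_left (by linarith)]; ring
  have hq1 : ∑ x, q x ≤ 1 := by
    rw [Fintype.sum_prod_type]
    refine le_trans (Finset.sum_le_sum fun i _ => ?_) hμ
    rw [Fin.sum_univ_four]
    simp only [hq, Matrix.cons_val]
    have h1 := hm (μ i).re
    have h2 := hm (μ i).im
    have h3 := Complex.abs_re_le_norm (μ i)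
    have h4 := Complex.abs_im_le_norm (μ i)
    linarith
  refine ⟨fun ω => ω.elim (1 - ∑ x, q x) q, ?_, ?_, ?_⟩
  · rintro (_ | x)
    · simpa using hq1
    · exact hq0 x
  · rw [Fintype.sum_option]
    simp
  · intro i
    rw [Fin.sum_univ_four]
    simp only [hq, Option.elim, Matrix.cons_val]
    apply Complex.ext
    · have := hm' (μ i).re
      simp [pow_succ]
      linarith
    · have := hm' (μ i).im
      simp [pow_succ]
      linarith

lemma norm_sum_mul_le_l2 {κ : Type*} [Fintype κ] (a w : κ → ℂ) :
    ‖∑ k, a k * w k‖ ≤ √(∑ k, ‖a k‖ ^ 2) * √(∑ k, ‖w k‖ ^ 2) := by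
  refine (norm_sum_le _ _).trans ?_
  simp_rw [norm_mul]
  exact Real.sum_mul_le_sqrt_mul_sqrt _ _ _

/-- If a sign matrix is well conditioned on sparse combinations of the units `v i`, then its
kernel contains only small convex combinations of the `v i`. -/
lemma exists_sign_matrix_kernel_small {ι κ : Type*} [Fintype ι] [Nonempty ι] [Fintype κ]
    (v : ι → κ → ℂ) (hv : ∀ i k, ‖v i k‖ ≤ 1) (m s : ℕ) (hm : 1 ≤ m) (hs : 1 ≤ s)
    (hms : 1456 * (s * log (5 * Fintype.card ι)) ≤ m) :
    ∃ G : Fin m → κ → Bool, ∀ μ : ι → ℂ, ∑ i, ‖μ i‖ ≤ 1 →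
      (∀ j, ∑ k, (∑ i, μ i * v i k) * (boolSign (G j k) : ℂ) = 0) →
      √(∑ k, ‖∑ i, μ i * v i k‖ ^ 2) ≤ 6 * √(68 * Fintype.card κ / s) := by
  set M := Fintype.card ι with hM
  have hM1 : 1 ≤ M := Fintype.card_pos
  have hm0 : (0 : ℝ) < m := by exact_mod_cast hm
  have hs0 : (0 : ℝ) < s := by exact_mod_cast hs
  have hMr : (1 : ℝ) ≤ M := by exact_mod_cast hM1
  have hl1 : 1 ≤ log (5 * M) := by
    rw [Real.le_log_iff_exp_le (by positivity)]
    have := Real.exp_one_lt_d9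
    linarith
  set w : Option (ι × Fin 4) → κ → ℂ := fun ω k =>
    ω.elim 0 fun x => Complex.I ^ (x.2 : ℕ) * v x.1 k with hw
  obtain ⟨G, hG1, hG2⟩ := exists_sign_matrix m
    (fun (f : Fin s → Option (ι × Fin 4)) k => ∑ j, w (f j) k) v (by
      have hc : (Fintype.card (Fin s → Option (ι × Fin 4)) : ℝ) ≤ exp (s * log (5 * M)) := by
        rw [Real.exp_nat_mul, Real.exp_log (by positivity)]
        simp only [Fintype.card_fun, Fintype.card_option, Fintype.card_prod, Fintype.card_fin]
        push_cast
        gcongr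
        linarith
      have h1 : exp (s * log (5 * M)) * exp (-(m / 728 : ℝ)) ≤ exp (-1) := by
        rw [← Real.exp_add]
        gcongr
        nlinarith [show (1 : ℝ) ≤ s from by exact_mod_cast hs]
      have h2 : (M : ℝ) * exp (-(m : ℝ)) ≤ 1 / 5 := by
        have : exp (-(m : ℝ)) ≤ exp (-log (5 * M)) := by
          gcongr
          nlinarith [show (1 : ℝ) ≤ s from by exact_mod_cast hs]
        rw [Real.exp_neg (log _), Real.exp_log (by positivity)] at this
        calc (M : ℝ) * exp (-(m : ℝ)) ≤ M * (5 * M : ℝ)⁻¹ := by gcongr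
          _ = 1 / 5 := by field_simp
      have h3 : exp (-1 : ℝ) < 1 / 2 := by
        rw [Real.exp_neg, inv_lt_comm₀ (by positivity) (by norm_num)]
        have := Real.exp_one_gt_d9
        norm_num; linarith
      calc _ ≤ exp (s * log (5 * M)) * exp (-(m / 728 : ℝ)) + M * exp (-(m : ℝ)) := by gcongr
        _ < 1 := by linarith)
  refine ⟨G, fun μ hμ hker => ?_⟩
  obtain ⟨p, hp0, hp1, hpμ⟩ := exists_convex_units μ hμ
  set W : Option (ι × Fin 4) → EuclideanSpace ℂ (κ ⊕ Fin m) := fun ω => WithLp.toLp 2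
    (Sum.elim (w ω) fun j => ((√m)⁻¹ : ℝ) * ∑ k, w ω k * (boolSign (G j k) : ℂ)) with hW
  have hnorm : ∀ z : κ → ℂ, ‖(WithLp.toLp 2 (Sum.elim z fun j => (((√m)⁻¹ : ℝ) : ℂ) *
      ∑ k, z k * (boolSign (G j k) : ℂ)) : EuclideanSpace ℂ (κ ⊕ Fin m))‖ ^ 2 =
      ∑ k, ‖z k‖ ^ 2 + (∑ j, signSq z (G j)) / m := by
    intro z
    rw [EuclideanSpace.norm_sq_eq, Fintype.sum_sum_type]
    simp only [Sum.elim_inl, Sum.elim_inr, norm_mul, mul_pow, ← Finset.mul_sum, signSq]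
    congr 1
    rw [Complex.norm_real, Real.norm_of_nonneg (by positivity), inv_pow, Real.sq_sqrt hm0.le]
    ring
  have hvk : ∀ i, ∑ k, ‖v i k‖ ^ 2 ≤ Fintype.card κ := by
    intro i
    calc ∑ k, ‖v i k‖ ^ 2 ≤ ∑ k : κ, (1 : ℝ) :=
          Finset.sum_le_sum fun k _ => pow_le_one₀ (norm_nonneg _) (hv i k)
      _ = Fintype.card κ := by simp
  have hWR : ∀ ω, ‖W ω‖ ≤ √(17 * Fintype.card κ) := by
    intro ω
    refine Real.le_sqrt_of_sq_le ?_
    rw [hnorm]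
    rcases ω with _ | ⟨i, u⟩
    · simp only [hw, Option.elim, signSq]
      simp
    · have e1 : ∑ k, ‖w (some (i, u)) k‖ ^ 2 = ∑ k, ‖v i k‖ ^ 2 := by
        simp [hw]
      have e2 : ∀ j, signSq (w (some (i, u))) (G j) = signSq (v i) (G j) := by
        intro j
        simp only [signSq, hw, Option.elim, mul_assoc, ← Finset.mul_sum]
        simp
      rw [e1]
      simp_rw [e2]
      have h1 := hG2 i
      have h2 : (∑ j, signSq (v i) (G j)) / m ≤ 16 * ∑ k, ‖v i k‖ ^ 2 := by
        rw [div_le_iff₀ hm0]; linarith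
      have := hvk i
      linarith
  obtain ⟨f, hf⟩ := exists_maurey_average p hp0 hp1 W hWR s
  set V : κ → ℂ := fun k => ∑ j, w (f j) k with hV
  set z : κ → ℂ := fun k => ∑ i, μ i * v i k with hz
  have havg : ∑ ω, (p ω : ℂ) • W ω = WithLp.toLp 2 (Sum.elim (fun k => z k / 2) fun _ => 0) := by
    have hzk : ∀ k, ∑ ω, (p ω : ℂ) * w ω k = z k / 2 := by
      intro k
      rw [Fintype.sum_option, Fintype.sum_prod_type]
      simp only [hw, hz, Option.elim, mul_zero, zero_add, Finset.sum_div]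
      refine Finset.sum_congr rfl fun i _ => ?_
      rw [hpμ i, Finset.mul_sum, Finset.sum_mul, Finset.sum_div]
      refine Finset.sum_congr rfl fun u _ => by ring
    ext x
    rcases x with k | j
    · simp only [hW, WithLp.ofLp_sum, WithLp.ofLp_smul, Finset.sum_apply, Pi.smul_apply,
        Sum.elim_inl, smul_eq_mul]
      exact hzk k
    · simp only [hW, WithLp.ofLp_sum, WithLp.ofLp_smul, Finset.sum_apply, Pi.smul_apply,
        Sum.elim_inr, smul_eq_mul]
      have : ∀ ω, (p ω : ℂ) * ((((√m)⁻¹ : ℝ) : ℂ) * ∑ k, w ω k * (boolSign (G j k) : ℂ)) =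
          (((√m)⁻¹ : ℝ) : ℂ) * ∑ k, ((p ω : ℂ) * w ω k) * (boolSign (G j k) : ℂ) := by
        intro ω
        rw [mul_left_comm, Finset.mul_sum]
        simp only [mul_assoc]
      simp_rw [this]
      rw [← Finset.mul_sum, Finset.sum_comm]
      simp_rw [← Finset.sum_mul, hzk]
      have h0 := hker j
      have : ∑ k, z k / 2 * (boolSign (G j k) : ℂ) = 0 := by
        rw [← zero_div (2 : ℂ), ← h0, Finset.sum_div]
        exact Finset.sum_congr rfl fun k _ => by ring
      rw [this, mul_zero]
  have hdiff : ∑ j, W (f j) - (s : ℂ) • ∑ ω, (p ω : ℂ) • W ω = WithLp.toLp 2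
      (Sum.elim (fun k => V k - s * (z k / 2)) fun j => (((√m)⁻¹ : ℝ) : ℂ) *
        ∑ k, V k * (boolSign (G j k) : ℂ)) := by
    rw [havg]
    ext x
    rcases x with k | j
    · simp [hW, hV]
    · simp only [hW, hV, WithLp.ofLp_sum, WithLp.ofLp_smul, WithLp.ofLp_sub, Finset.sum_apply,
        Pi.smul_apply, Pi.sub_apply, Sum.elim_inr, smul_zero, sub_zero]
      rw [← Finset.mul_sum, Finset.sum_comm]
      simp only [Finset.sum_mul]
  rw [hdiff, EuclideanSpace.norm_sq_eq, Fintype.sum_sum_type, mul_pow, Real.sq_sqrt (by positivity)]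
    at hf
  simp only [Sum.elim_inl, Sum.elim_inr, norm_mul, mul_pow, ← Finset.mul_sum] at hf
  rw [Complex.norm_real, Real.norm_of_nonneg (by positivity), inv_pow, Real.sq_sqrt hm0.le] at hf
  have hf2 : ∑ k, ‖V k - s * (z k / 2)‖ ^ 2 + (∑ j, signSq V (G j)) / m ≤
      68 * Fintype.card κ * s := by
    rw [div_eq_inv_mul]
    refine hf.trans (le_of_eq (by ring))
  have hVlow := hG1 f
  have hsg : 0 ≤ (∑ j, signSq V (G j)) / m :=
    div_nonneg (Finset.sum_nonneg fun j _ => signSq_nonneg _ _) hm0.le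
  have hsq0 : 0 ≤ ∑ k, ‖V k - s * (z k / 2)‖ ^ 2 := Finset.sum_nonneg fun k _ => by positivity
  have hV2 : ∑ k, ‖V k‖ ^ 2 ≤ 4 * (68 * Fintype.card κ * s) := by
    have : (∑ k, ‖V k‖ ^ 2) / 4 ≤ (∑ j, signSq V (G j)) / m := by
      rw [le_div_iff₀ hm0]; linarith
    linarith
  have hd2 : ∑ k, ‖V k - s * (z k / 2)‖ ^ 2 ≤ 68 * Fintype.card κ * s := by linarith
  have hz2 : ∑ k, ‖(s : ℂ) * (z k / 2)‖ ^ 2 ≤ 9 * (68 * Fintype.card κ * s) := by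
    have hpt : ∀ k, ‖(s : ℂ) * (z k / 2)‖ ^ 2 ≤
        3 / 2 * ‖V k‖ ^ 2 + 3 * ‖V k - s * (z k / 2)‖ ^ 2 := by
      intro k
      have h1 : ‖(s : ℂ) * (z k / 2)‖ ≤ ‖V k‖ + ‖V k - s * (z k / 2)‖ := by
        calc _ = ‖V k - (V k - s * (z k / 2))‖ := by ring_nf
          _ ≤ _ := norm_sub_le _ _
      have h2 : ‖(s : ℂ) * (z k / 2)‖ ^ 2 ≤ (‖V k‖ + ‖V k - s * (z k / 2)‖) ^ 2 := by gcongr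
      nlinarith [sq_nonneg (‖V k‖ - 2 * ‖V k - s * (z k / 2)‖)]
    refine (Finset.sum_le_sum fun k _ => hpt k).trans ?_
    rw [Finset.sum_add_distrib, ← Finset.mul_sum, ← Finset.mul_sum]
    linarith
  have e6 : (6 : ℝ) * √(68 * Fintype.card κ / s) = √(36 * (68 * Fintype.card κ / s)) := by
    rw [Real.sqrt_mul (by norm_num), show (36 : ℝ) = 6 ^ 2 by norm_num,
      Real.sqrt_sq (by norm_num)]
  rw [e6]
  refine Real.sqrt_le_sqrt ?_
  have hz3 : ∑ k, ‖(s : ℂ) * (z k / 2)‖ ^ 2 = (s : ℝ) ^ 2 / 4 * ∑ k, ‖z k‖ ^ 2 := by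
    rw [Finset.mul_sum]
    refine Finset.sum_congr rfl fun k _ => ?_
    rw [norm_mul, norm_div, Complex.norm_natCast]
    norm_num
    ring
  rw [hz3] at hz2
  rw [mul_div_assoc', le_div_iff₀ hs0]
  have : (s : ℝ) * (s * ∑ k, ‖z k‖ ^ 2) ≤ s * (36 * (68 * Fintype.card κ)) := by nlinarith
  have := le_of_mul_le_mul_left this hs0
  linarith

/-- Kolmogorov widths of Euclidean balls in the maximum norm. -/
lemma exists_kolmogorov_subspace {ι κ : Type*} [Fintype ι] [Nonempty ι] [Fintype κ]
    (v : ι → κ → ℂ) (hv : ∀ i k, ‖v i k‖ ≤ 1) (m : ℕ) (hm : 1 ≤ m) :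
    ∃ L : Submodule ℂ (κ → ℂ), Module.finrank ℂ L < m ∧ ∀ a : κ → ℂ, ∃ b ∈ L, ∀ i,
      ‖∑ k, (a k - b k) * v i k‖ ≤
        4000 * √(Fintype.card κ * log (5 * Fintype.card ι) / m) * √(∑ k, ‖a k‖ ^ 2) := by
  set M := Fintype.card ι with hM
  have hM1 : 1 ≤ M := Fintype.card_pos
  have hm0 : (0 : ℝ) < m := by exact_mod_cast hm
  have hMr : (1 : ℝ) ≤ M := by exact_mod_cast hM1
  have hl1 : 1 ≤ log (5 * M) := by
    rw [Real.le_log_iff_exp_le (by positivity)]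
    have := Real.exp_one_lt_d9
    linarith
  set ℓ := log (5 * M) with hℓ
  set s := ⌊((m - 1 : ℕ) : ℝ) / (1456 * ℓ)⌋₊ with hs
  have hs2 := Nat.lt_floor_add_one (((m - 1 : ℕ) : ℝ) / (1456 * ℓ))
  rw [← hs, div_lt_iff₀ (by positivity)] at hs2
  have hcast : ((m - 1 : ℕ) : ℝ) = m - 1 := by
    rw [Nat.cast_sub hm]; simp
  have hκ0 : (0 : ℝ) ≤ Fintype.card κ := by positivity
  rcases Nat.eq_zero_or_pos s with h0 | hpos
  · refine ⟨⊥, by rw [finrank_bot]; omega, fun a => ⟨0, Submodule.zero_mem _, fun i => ?_⟩⟩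
    simp only [Pi.zero_apply, sub_zero]
    refine (norm_sum_mul_le_l2 a (v i)).trans ?_
    rw [mul_comm]
    gcongr
    have hvk : ∑ k, ‖v i k‖ ^ 2 ≤ Fintype.card κ := by
      calc ∑ k, ‖v i k‖ ^ 2 ≤ ∑ k : κ, (1 : ℝ) :=
            Finset.sum_le_sum fun k _ => pow_le_one₀ (norm_nonneg _) (hv i k)
        _ = Fintype.card κ := by simp
    have e : (4000 : ℝ) * √(Fintype.card κ * ℓ / m) = √(4000 ^ 2 * (Fintype.card κ * ℓ / m)) := by
      rw [Real.sqrt_mul (by norm_num), Real.sqrt_sq (by norm_num)]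
    rw [e]
    refine Real.sqrt_le_sqrt (hvk.trans ?_)
    rw [mul_div_assoc', le_div_iff₀ hm0]
    rw [h0, hcast] at hs2
    have : (m : ℝ) ≤ 4000 ^ 2 * ℓ := by
      push_cast at hs2; linarith
    nlinarith
  · have hms : 1456 * (s * ℓ) ≤ ((m - 1 : ℕ) : ℝ) := by
      have := Nat.floor_le (a := ((m - 1 : ℕ) : ℝ) / (1456 * ℓ)) (by positivity)
      rw [← hs, le_div_iff₀ (by positivity)] at this
      linarith
    have hs1 : (1 : ℝ) ≤ s := by exact_mod_cast hpos
    have hm1 : 1 ≤ m - 1 := by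
      have : (1 : ℝ) ≤ ((m - 1 : ℕ) : ℝ) := by nlinarith
      exact_mod_cast this
    obtain ⟨G, hG⟩ := exists_sign_matrix_kernel_small v hv (m - 1) s hm1 hpos hms
    let Φ : (Fin (m - 1) → ℂ) →ₗ[ℂ] (κ → ℂ) :=
      Fintype.linearCombination ℂ fun j k => (boolSign (G j k) : ℂ)
    let E : (κ → ℂ) →ₗ[ℂ] (ι → ℂ) := Matrix.mulVecLin (Matrix.of v)
    have hE : ∀ b i, E b i = ∑ k, b k * v i k := by
      intro b i
      simp [E, Matrix.mulVec, dotProduct, mul_comm]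
    refine ⟨LinearMap.range Φ, ?_, fun a => ?_⟩
    · refine (LinearMap.finrank_range_le Φ).trans_lt ?_
      simp
      omega
    · obtain ⟨l, ⟨b, hb, rfl⟩, hl2⟩ := exists_near_of_annihilator ((LinearMap.range Φ).map E) (E a)
        (D := 4000 * √(Fintype.card κ * ℓ / m) * √(∑ k, ‖a k‖ ^ 2)) (by
        intro μ hμ hann
        have hk := hG μ hμ (by
          intro j
          have := hann (E (Φ (Pi.single j 1))) ⟨_, ⟨_, rfl⟩, rfl⟩
          simp only [hE] at this
          rw [← this]
          simp only [Φ, Fintype.linearCombination_apply_single, one_smul, Finset.mul_sum,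
            Finset.sum_mul]
          rw [Finset.sum_comm]
          exact Finset.sum_congr rfl fun i _ => Finset.sum_congr rfl fun k _ => by ring)
        have e : ∑ i, μ i * E a i = ∑ k, a k * ∑ i, μ i * v i k := by
          simp only [hE, Finset.mul_sum]
          rw [Finset.sum_comm]
          exact Finset.sum_congr rfl fun i _ => Finset.sum_congr rfl fun k _ => by ring
        rw [e]
        refine (norm_sum_mul_le_l2 _ _).trans ?_
        rw [mul_comm]
        gcongr
        refine hk.trans ?_
        have hsm : (m : ℝ) ≤ 5824 * ℓ * s := by
          rw [hcast] at hs2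
          have : (1 : ℝ) ≤ ((m - 1 : ℕ) : ℝ) := by exact_mod_cast hm1
          rw [hcast] at this
          nlinarith
        have h1 : (68 * Fintype.card κ / s : ℝ) ≤
            (4000 / 6) ^ 2 * (Fintype.card κ * ℓ / m) := by
          rw [mul_div_assoc', div_le_div_iff₀ (by linarith) hm0]
          have h3 : 68 * (Fintype.card κ : ℝ) * m ≤ 68 * Fintype.card κ * (5824 * ℓ * s) := by gcongr
          have h4 : 0 ≤ (Fintype.card κ : ℝ) * ℓ * s := by positivity
          linarith
        calc 6 * √(68 * Fintype.card κ / s) ≤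
              6 * √((4000 / 6) ^ 2 * (Fintype.card κ * ℓ / m)) := by gcongr
          _ = _ := by
            rw [Real.sqrt_mul (by norm_num), Real.sqrt_sq (by norm_num)]; ring)
      refine ⟨b, hb, fun i => ?_⟩
      have := (norm_le_pi_norm (E a - E b) i).trans hl2
      rw [← map_sub, hE] at this
      exact this

theorem trigChar_apply {d : ℕ} (k : Fin d → ℤ) (x : Torus d) :
    trigChar k x = ∏ j, fourier (k j) (x j) := rfl

theorem norm_trigChar {d : ℕ} (k : Fin d → ℤ) (x : Torus d) : ‖trigChar k x‖ = 1 := by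
  rw [trigChar_apply, norm_prod]
  exact Finset.prod_eq_one fun j _ => by rw [fourier_apply, Circle.norm_coe]

theorem trigChar_add {d : ℕ} (k l : Fin d → ℤ) :
    (trigChar (k + l) : C(Torus d, ℂ)) = trigChar k * trigChar l := by
  ext x
  simp only [trigChar_apply, ContinuousMap.mul_apply, Pi.add_apply, fourier_add,
    Finset.prod_mul_distrib]

theorem conj_trigChar {d : ℕ} (k : Fin d → ℤ) (x : Torus d) :
    conj (trigChar k x) = trigChar (-k) x := by
  simp only [trigChar_apply, map_prod, Pi.neg_apply, fourier_neg]

theorem integral_fourier_addCircle (n : ℤ) :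
    ∫ x : AddCircle (2 * π), fourier n x = if n = 0 then (2 * π : ℂ) else 0 := by
  have h := orthonormal_iff_ite.mp (orthonormal_fourier (T := 2 * π)) 0 n
  have h2 : ∫ x : AddCircle (2 * π), fourier n x ∂AddCircle.haarAddCircle =
      if n = 0 then (1 : ℂ) else 0 := by
    have : inner ℂ (fourierLp (T := 2 * π) 2 0) (fourierLp 2 n) =
        ∫ x : AddCircle (2 * π), fourier n x * conj (fourier 0 x) ∂AddCircle.haarAddCircle :=
      ContinuousMap.inner_toLp _ _ _
    rw [h] at this
    simp only [fourier_zero, map_one, mul_one] at this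
    rw [← this]
    simp [eq_comm]
  rw [AddCircle.volume_eq_smul_haarAddCircle, integral_smul_measure, h2,
    ENNReal.toReal_ofReal (by positivity)]
  split_ifs <;> simp

theorem integral_trigChar {d : ℕ} (k : Fin d → ℤ) :
    ∫ x : Torus d, trigChar k x = if k = 0 then ((2 * π : ℝ) ^ d : ℂ) else 0 := by
  simp only [trigChar_apply]
  rw [integral_fintype_prod_volume_eq_prod (fun j (y : AddCircle (2 * π)) => fourier (k j) y)]
  simp only [integral_fourier_addCircle]
  split_ifs with h
  · subst h; simp
  · obtain ⟨j, hj⟩ := Function.ne_iff.mp h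
    exact Finset.prod_eq_zero (Finset.mem_univ j) (if_neg hj)

theorem integral_conj_trigChar_mul {d : ℕ} (k l : Fin d → ℤ) :
    ∫ x : Torus d, conj (trigChar k x) * trigChar l x =
      if k = l then ((2 * π : ℝ) ^ d : ℂ) else 0 := by
  have : ∀ x : Torus d, conj (trigChar k x) * trigChar l x = trigChar (-k + l) x := by
    intro x
    rw [conj_trigChar, trigChar_add]; rfl
  simp_rw [this, integral_trigChar, neg_add_eq_zero]

theorem integrable_of_continuousMap {d : ℕ} (f : C(Torus d, ℂ)) : Integrable f :=
  f.continuous.integrable_of_hasCompactSupport (HasCompactSupport.of_compactSpace _)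

theorem torusMass_pos (d : ℕ) : (0 : ℝ) < (2 * π) ^ d := by positivity

theorem volume_real_torus (d : ℕ) : volume.real (Set.univ : Set (Torus d)) = (2 * π) ^ d := by
  simp [Measure.real, volume_pi, Measure.pi_univ, AddCircle.measure_univ, ENNReal.toReal_ofReal Real.pi_pos.le]

/-- The trigonometric polynomial with frequencies in `E` and coefficients `a`. -/
def trigPoly {d : ℕ} (E : Finset (Fin d → ℤ)) (a : (Fin d → ℤ) → ℂ) : C(Torus d, ℂ) :=
  ∑ k ∈ E, a k • trigChar k

theorem trigPoly_apply {d : ℕ} (E : Finset (Fin d → ℤ)) (a : (Fin d → ℤ) → ℂ) (x : Torus d) :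
    trigPoly E a x = ∑ k ∈ E, a k * trigChar k x := by
  simp [trigPoly, ContinuousMap.sum_apply]

theorem integrable_conj_trigChar_mul {d : ℕ} {f : Torus d → ℂ} (hf : Integrable f)
    (k : Fin d → ℤ) : Integrable fun x => conj (trigChar k x) * f x := by
  refine hf.bdd_mul (c := 1) ?_ ?_
  · exact (Complex.continuous_conj.comp (trigChar k).continuous).aestronglyMeasurable
  · exact Filter.Eventually.of_forall fun x => by simp [norm_trigChar]

theorem integral_conj_trigChar_mul_eq {d : ℕ} (f : Torus d → ℂ) (k : Fin d → ℤ) :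
    ∫ x, conj (trigChar k x) * f x = ((2 * π : ℝ) ^ d : ℂ) * fCoeff f k := by
  have hc : ((2 * π : ℝ) ^ d : ℂ) ≠ 0 := by exact_mod_cast (torusMass_pos d).ne'
  rw [fCoeff, Complex.real_smul]
  push_cast at hc ⊢
  rw [← mul_assoc, mul_inv_cancel₀ hc, one_mul]

theorem fCoeff_add {d : ℕ} {f g : Torus d → ℂ} (hf : Integrable f) (hg : Integrable g)
    (k : Fin d → ℤ) : fCoeff (fun x => f x + g x) k = fCoeff f k + fCoeff g k := by
  simp only [fCoeff, mul_add]
  rw [integral_add (integrable_conj_trigChar_mul hf k) (integrable_conj_trigChar_mul hg k),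
    smul_add]

theorem fCoeff_trigPoly {d : ℕ} (E : Finset (Fin d → ℤ)) (a : (Fin d → ℤ) → ℂ)
    (k : Fin d → ℤ) : fCoeff (trigPoly E a) k = if k ∈ E then a k else 0 := by
  have hc : ((2 * π : ℝ) ^ d : ℂ) ≠ 0 := by exact_mod_cast (torusMass_pos d).ne'
  have h := integral_conj_trigChar_mul_eq (trigPoly E a) k
  rw [← mul_right_inj' hc, ← h]
  simp only [trigPoly_apply, Finset.mul_sum]
  have : ∀ l ∈ E, Integrable fun x : Torus d =>
      conj (trigChar k x) * (a l * trigChar l x) := by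
    intro l _
    exact integrable_conj_trigChar_mul ((integrable_of_continuousMap (trigChar l)).const_mul _) k
  rw [integral_finsetSum _ this]
  simp_rw [mul_left_comm _ (a _), integral_const_mul, integral_conj_trigChar_mul]
  simp [mul_comm]

theorem integral_conj_trigPoly_mul {d : ℕ} (E : Finset (Fin d → ℤ)) (a : (Fin d → ℤ) → ℂ)
    {f : Torus d → ℂ} (hf : Integrable f) :
    ∫ x, conj (trigPoly E a x) * f x =
      ((2 * π : ℝ) ^ d : ℂ) * ∑ k ∈ E, conj (a k) * fCoeff f k := by
  simp only [trigPoly_apply, map_sum, map_mul, Finset.sum_mul, mul_assoc]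
  rw [integral_finsetSum _ fun k _ => (integrable_conj_trigChar_mul hf k).const_mul _]
  simp_rw [integral_const_mul, integral_conj_trigChar_mul_eq, Finset.mul_sum]
  exact Finset.sum_congr rfl fun k _ => by ring

theorem integral_norm_trigPoly_sq {d : ℕ} (E : Finset (Fin d → ℤ)) (a : (Fin d → ℤ) → ℂ) :
    ∫ x, ‖trigPoly E a x‖ ^ 2 = (2 * π) ^ d * ∑ k ∈ E, ‖a k‖ ^ 2 := by
  have h := integral_conj_trigPoly_mul E a (integrable_of_continuousMap (trigPoly E a))
  simp only [fCoeff_trigPoly] at h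
  have h1 : ∀ x, conj (trigPoly E a x) * trigPoly E a x = ((‖trigPoly E a x‖ ^ 2 : ℝ) : ℂ) := by
    intro x; rw [Complex.conj_mul']; push_cast; rfl
  simp_rw [h1] at h
  rw [integral_complex_ofReal] at h
  have h2 : ∑ k ∈ E, conj (a k) * (if k ∈ E then a k else 0) = ((∑ k ∈ E, ‖a k‖ ^ 2 : ℝ) : ℂ) := by
    push_cast
    refine Finset.sum_congr rfl fun k hk => ?_
    rw [if_pos hk, Complex.conj_mul']
  rw [h2] at h
  exact_mod_cast h

theorem sum_norm_fCoeff_sq_le {d : ℕ} (E : Finset (Fin d → ℤ)) {f : Torus d → ℂ}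
    (hf : MemLp f 2) : (2 * π) ^ d * ∑ k ∈ E, ‖fCoeff f k‖ ^ 2 ≤ ∫ x, ‖f x‖ ^ 2 := by
  have hfi : Integrable f := hf.integrable one_le_two
  set S := trigPoly E (fCoeff f) with hS
  have h := integral_conj_trigPoly_mul E (fCoeff f) hfi
  have h2 : ∑ k ∈ E, conj (fCoeff f k) * fCoeff f k = ((∑ k ∈ E, ‖fCoeff f k‖ ^ 2 : ℝ) : ℂ) := by
    push_cast
    exact Finset.sum_congr rfl fun k hk => by rw [Complex.conj_mul']
  rw [h2] at h
  have hint : Integrable fun x => conj (S x) * f x := by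
    obtain ⟨C, hC⟩ := (isCompact_range S.continuous).isBounded.exists_norm_le
    refine hfi.bdd_mul (c := C) ?_ ?_
    · exact (Complex.continuous_conj.comp S.continuous).aestronglyMeasurable
    · exact Filter.Eventually.of_forall fun x => by simpa using hC _ ⟨x, rfl⟩
  have hre : ∫ x, (conj (S x) * f x).re = (2 * π) ^ d * ∑ k ∈ E, ‖fCoeff f k‖ ^ 2 := by
    have := integral_re hint
    simp only [RCLike.re_to_complex] at this
    rw [this, h]
    norm_cast
  have hpos : 0 ≤ ∫ x, ‖f x - S x‖ ^ 2 := integral_nonneg fun x => by positivity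
  have hexp : ∀ x, ‖f x - S x‖ ^ 2 = ‖f x‖ ^ 2 - 2 * (conj (S x) * f x).re + ‖S x‖ ^ 2 := by
    intro x
    rw [← Complex.normSq_eq_norm_sq, ← Complex.normSq_eq_norm_sq, ← Complex.normSq_eq_norm_sq,
      Complex.normSq_sub, mul_comm (f x)]
    ring
  have hf2 : Integrable fun x => ‖f x‖ ^ 2 := hf.integrable_norm_pow two_ne_zero
  have hS2 : Integrable fun x => ‖S x‖ ^ 2 :=
    (S.continuous.norm.pow 2).integrable_of_hasCompactSupport (HasCompactSupport.of_compactSpace _)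
  simp_rw [hexp] at hpos
  have hr : Integrable fun x => 2 * (conj (S x) * f x).re := hint.re.const_mul 2
  have hd : Integrable fun x => ‖f x‖ ^ 2 - 2 * (conj (S x) * f x).re := hf2.sub hr
  rw [integral_add hd hS2, integral_sub hf2 hr, integral_norm_trigPoly_sq,
    integral_const_mul, hre] at hpos
  linarith

/-- The `L_q` norm of a continuous function on the torus. -/
def lqNorm {d : ℕ} (q : ℕ) (f : C(Torus d, ℂ)) : ℝ :=
  (eLpNorm f q (volume : Measure (Torus d))).toReal

theorem memLp_of_continuousMap {d : ℕ} (q : ℝ≥0∞) (f : C(Torus d, ℂ)) :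
    MemLp f q (volume : Measure (Torus d)) := by
  obtain ⟨C, hC⟩ := (isCompact_range f.continuous).isBounded.exists_norm_le
  exact MemLp.of_bound f.continuous.aestronglyMeasurable C
    (Filter.Eventually.of_forall fun x => hC _ ⟨x, rfl⟩)

theorem lqNorm_nonneg {d : ℕ} (q : ℕ) (f : C(Torus d, ℂ)) : 0 ≤ lqNorm q f :=
  ENNReal.toReal_nonneg

theorem lqNorm_add_le {d : ℕ} {q : ℕ} (hq : 1 ≤ q) (f g : C(Torus d, ℂ)) :
    lqNorm q (f + g) ≤ lqNorm q f + lqNorm q g := by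
  have hf := memLp_of_continuousMap q f
  have hg := memLp_of_continuousMap q g
  rw [lqNorm, lqNorm, lqNorm, ← ENNReal.toReal_add hf.eLpNorm_ne_top hg.eLpNorm_ne_top]
  refine ENNReal.toReal_mono (ENNReal.add_ne_top.2 ⟨hf.eLpNorm_ne_top, hg.eLpNorm_ne_top⟩) ?_
  exact eLpNorm_add_le hf.1 hg.1 (by exact_mod_cast hq)

theorem lqNorm_smul {d : ℕ} (q : ℕ) (c : ℂ) (f : C(Torus d, ℂ)) :
    lqNorm q (c • f) = ‖c‖ * lqNorm q f := by
  rw [lqNorm, ContinuousMap.coe_smul, eLpNorm_const_smul, ENNReal.toReal_mul]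
  simp [lqNorm]

theorem lqNorm_neg {d : ℕ} (q : ℕ) (f : C(Torus d, ℂ)) : lqNorm q (-f) = lqNorm q f := by
  rw [lqNorm, ContinuousMap.coe_neg, eLpNorm_neg, lqNorm]

theorem lqNorm_pow {d : ℕ} {q : ℕ} (hq : 1 ≤ q) (f : C(Torus d, ℂ)) :
    lqNorm q f ^ q = ∫ x, ‖f x‖ ^ q := by
  have hf := memLp_of_continuousMap q f
  have hq0 : (q : ℝ) ≠ 0 := by positivity
  rw [lqNorm, hf.eLpNorm_eq_integral_rpow_norm (by exact_mod_cast (by omega : q ≠ 0))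
    (ENNReal.natCast_ne_top q), ENNReal.toReal_ofReal (by positivity)]
  simp only [ENNReal.toReal_natCast, rpow_natCast]
  rw [← rpow_natCast, ← rpow_mul (integral_nonneg fun x => by positivity),
    inv_mul_cancel₀ hq0, rpow_one]

theorem lqNorm_mul_le {d : ℕ} (q : ℕ) (f g : C(Torus d, ℂ)) :
    lqNorm q (f * g) ≤ lqNorm (2 * q) f * lqNorm (2 * q) g := by
  have hf := memLp_of_continuousMap (2 * q : ℕ) f
  have hg := memLp_of_continuousMap (2 * q : ℕ) g
  have : ENNReal.HolderTriple (2 * q : ℕ) (2 * q : ℕ) q := ⟨by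
    push_cast
    rw [ENNReal.mul_inv (by simp) (by simp), ← two_mul, ← mul_assoc,
      ENNReal.mul_inv_cancel (by simp) (by simp), one_mul]⟩
  rw [lqNorm, lqNorm, lqNorm, ← ENNReal.toReal_mul]
  refine ENNReal.toReal_mono (ENNReal.mul_ne_top hf.eLpNorm_ne_top hg.eLpNorm_ne_top) ?_
  have h := eLpNorm_smul_le_mul_eLpNorm (p := (2 * q : ℕ)) (q := (2 * q : ℕ)) (r := q) hg.1 hf.1
  have e : (⇑f • ⇑g : Torus d → ℂ) = ⇑(f * g) := by
    ext x
    simp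
  rwa [e] at h

theorem lqNorm_mul_self {d : ℕ} {q : ℕ} (hq : 1 ≤ q) (f : C(Torus d, ℂ)) :
    lqNorm q (f * f) = lqNorm (2 * q) f ^ 2 := by
  refine (pow_left_inj₀ (lqNorm_nonneg _ _) (sq_nonneg _) (by omega : q ≠ 0)).1 ?_
  rw [lqNorm_pow hq, ← pow_mul, lqNorm_pow (by omega)]
  refine integral_congr_ae (Filter.Eventually.of_forall fun x => ?_)
  simp only [ContinuousMap.mul_apply, norm_mul]
  ring

theorem lqNorm_mul_trigChar {d : ℕ} (q : ℕ) (f : C(Torus d, ℂ)) (k : Fin d → ℤ) :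
    lqNorm q (f * trigChar k) = lqNorm q f := by
  rw [lqNorm, lqNorm]
  congr 1
  refine eLpNorm_congr_norm_ae (Filter.Eventually.of_forall fun x => ?_)
  simp [norm_trigChar]

/-- The span of the characters whose frequencies belong to `S`. -/
def freqSpan {d : ℕ} (S : Set (Fin d → ℤ)) : Submodule ℂ C(Torus d, ℂ) :=
  Submodule.span ℂ (trigChar '' S)

theorem mul_mem_freqSpan {d : ℕ} {S T U : Set (Fin d → ℤ)}
    (h : ∀ k ∈ S, ∀ l ∈ T, k + l ∈ U) {f g : C(Torus d, ℂ)}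
    (hf : f ∈ freqSpan S) (hg : g ∈ freqSpan T) : f * g ∈ freqSpan U := by
  have := Submodule.mul_mem_mul hf hg
  rw [freqSpan, freqSpan, Submodule.span_mul_span] at this
  refine Submodule.span_mono ?_ this
  rintro _ ⟨_, ⟨k, hk, rfl⟩, _, ⟨l, hl, rfl⟩, rfl⟩
  exact ⟨k + l, h k hk l hl, trigChar_add k l⟩

theorem trigPoly_mem_freqSpan {d : ℕ} {S : Set (Fin d → ℤ)} (E : Finset (Fin d → ℤ))
    {a : (Fin d → ℤ) → ℂ} (h : ∀ k, a k ≠ 0 → k ∈ S) : trigPoly E a ∈ freqSpan S := by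
  refine Submodule.sum_mem _ fun k _ => ?_
  by_cases hk : a k = 0
  · rw [hk, zero_smul]; exact Submodule.zero_mem _
  · exact Submodule.smul_mem _ _ (Submodule.subset_span ⟨k, h k hk, rfl⟩)

theorem integral_conj_mul_eq_zero_of_mem_freqSpan {d : ℕ} {S T : Set (Fin d → ℤ)}
    (hST : Disjoint S T) {f g : C(Torus d, ℂ)} (hf : f ∈ freqSpan S) (hg : g ∈ freqSpan T) :
    ∫ x, conj (f x) * g x = 0 := by
  have hint : ∀ f g : C(Torus d, ℂ), Integrable fun x => conj (f x) * g x := fun f g =>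
    integrable_of_continuousMap (star f * g)
  induction hf using Submodule.span_induction with
  | mem f hf =>
    obtain ⟨k, hk, rfl⟩ := hf
    induction hg using Submodule.span_induction with
    | mem g hg =>
      obtain ⟨l, hl, rfl⟩ := hg
      rw [integral_conj_trigChar_mul, if_neg]
      rintro rfl
      exact Set.disjoint_left.mp hST hk hl
    | zero => simp
    | add g₁ g₂ _ _ h₁ h₂ =>
      simp only [ContinuousMap.add_apply, mul_add]
      rw [integral_add (hint _ _) (hint _ _), h₁, h₂, add_zero]
    | smul c g _ h =>
      simp only [ContinuousMap.smul_apply, smul_eq_mul, mul_left_comm _ c]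
      rw [integral_const_mul, h, mul_zero]
  | zero => simp
  | add f₁ f₂ _ _ h₁ h₂ =>
    simp only [ContinuousMap.add_apply, map_add, add_mul]
    rw [integral_add (hint _ _) (hint _ _), h₁, h₂, add_zero]
  | smul c f _ h =>
    simp only [ContinuousMap.smul_apply, smul_eq_mul, map_mul, mul_assoc]
    rw [integral_const_mul, h, mul_zero]

theorem lqNorm_two_le_of_mem_freqSpan {d : ℕ} {S T : Set (Fin d → ℤ)}
    (hST : Disjoint S T) {g h : C(Torus d, ℂ)} (hg : g ∈ freqSpan S) (hh : h ∈ freqSpan T) :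
    lqNorm 2 g ≤ lqNorm 2 (g + h) := by
  refine (pow_le_pow_iff_left₀ (lqNorm_nonneg _ _) (lqNorm_nonneg _ _) two_ne_zero).1 ?_
  rw [lqNorm_pow one_le_two, lqNorm_pow one_le_two]
  have h0 := integral_conj_mul_eq_zero_of_mem_freqSpan hST hg hh
  have hint : Integrable fun x => conj (g x) * h x := integrable_of_continuousMap (star g * h)
  have hre : ∫ x, (conj (g x) * h x).re = 0 := by
    have := integral_re hint
    simp only [RCLike.re_to_complex] at this
    rw [this, h0, Complex.zero_re]
  have hsq : ∀ f : C(Torus d, ℂ), Integrable fun x => ‖f x‖ ^ 2 := fun f =>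
    (memLp_of_continuousMap 2 f).integrable_norm_pow two_ne_zero
  have hr : Integrable fun x => 2 * (conj (g x) * h x).re := hint.re.const_mul 2
  have hexp : ∀ x, ‖(g + h) x‖ ^ 2 = ‖g x‖ ^ 2 + 2 * (conj (g x) * h x).re + ‖h x‖ ^ 2 := by
    intro x
    rw [ContinuousMap.add_apply, ← Complex.normSq_eq_norm_sq, ← Complex.normSq_eq_norm_sq,
      ← Complex.normSq_eq_norm_sq, Complex.normSq_add, mul_comm (conj (g x)),
      ← Complex.conj_re (h x * _), map_mul, Complex.conj_conj, mul_comm (conj (h x))]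
    ring
  have hgr : Integrable fun x => ‖g x‖ ^ 2 + 2 * (conj (g x) * h x).re := (hsq g).add hr
  simp_rw [hexp]
  rw [integral_add hgr (hsq h), integral_add (hsq g) hr, integral_const_mul, hre]
  have : 0 ≤ ∫ x, ‖h x‖ ^ 2 := integral_nonneg fun x => by positivity
  linarith

/-- Boundedness of the analytic projection in `L_{2^{k+1}}`. -/
theorem exists_lqNorm_le_lqNorm_add {d : ℕ} (k : ℕ) :
    ∃ C : ℝ, 1 ≤ C ∧ ∀ (j : Fin d) (g h : C(Torus d, ℂ)), g ∈ freqSpan {k | 0 ≤ k j} →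
      h ∈ freqSpan {k | k j < 0} → lqNorm (2 ^ (k + 1)) g ≤ C * lqNorm (2 ^ (k + 1)) (g + h) := by
  induction k with
  | zero =>
    refine ⟨1, le_rfl, fun j g h hg hh => ?_⟩
    rw [one_mul]
    refine lqNorm_two_le_of_mem_freqSpan ?_ hg hh
    exact Set.disjoint_left.mpr fun k (hk : 0 ≤ k j) (hk' : k j < 0) => by omega
  | succ k ih =>
    obtain ⟨C, hC, ih⟩ := ih
    refine ⟨2 * C + 1, by linarith, fun j g h hg hh => ?_⟩
    have h1 : 1 ≤ 2 ^ (k + 1) := Nat.one_le_two_pow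
    have hgg := mul_mem_freqSpan (U := {k : Fin d → ℤ | 0 ≤ k j})
      (fun k (hk : 0 ≤ k j) l (hl : 0 ≤ l j) => add_nonneg hk hl) hg hg
    have hhh := mul_mem_freqSpan (U := {k : Fin d → ℤ | k j < 0})
      (fun k (hk : k j < 0) l (hl : l j < 0) => add_neg hk hl) hh hh
    have key := ih j _ _ hgg (Submodule.neg_mem _ hhh)
    have e : g * g + -(h * h) = (g + h) * (g + g + -(g + h)) := by ring
    rw [e, lqNorm_mul_self h1] at key
    have h2 := lqNorm_mul_le (2 ^ (k + 1)) (g + h) (g + g + -(g + h))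
    rw [show 2 ^ (k + 1 + 1) = 2 * 2 ^ (k + 1) by ring]
    have h3 := lqNorm_add_le (by omega : 1 ≤ 2 * 2 ^ (k + 1)) (g + g) (-(g + h))
    have h4 := lqNorm_add_le (by omega : 1 ≤ 2 * 2 ^ (k + 1)) g g
    rw [lqNorm_neg] at h3
    set X := lqNorm (2 * 2 ^ (k + 1)) g
    set Y := lqNorm (2 * 2 ^ (k + 1)) (g + h)
    have hX : 0 ≤ X := lqNorm_nonneg _ _
    have hY : 0 ≤ Y := lqNorm_nonneg _ _
    have h5 : X ^ 2 ≤ C * (Y * (2 * X + Y)) := by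
      refine key.trans (mul_le_mul_of_nonneg_left (h2.trans ?_) (by linarith))
      exact mul_le_mul_of_nonneg_left (by linarith) hY
    by_contra! hlt
    have h6 : Y * ((2 * C + 1) * Y) ≤ Y * X := mul_le_mul_of_nonneg_left hlt.le hY
    have h7 : 0 ≤ (2 * C + 1) * Y := by positivity
    have h8 : 0 < X := h7.trans_lt hlt
    nlinarith [mul_lt_mul_of_pos_right hlt h8, mul_nonneg hY hY]

/-- `m` is a Fourier multiplier on trigonometric polynomials in `L_q` with norm at most `K`. -/
def IsMultBound {d : ℕ} (q : ℕ) (K : ℝ) (m : (Fin d → ℤ) → ℂ) : Prop :=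
  ∀ E a, lqNorm q (trigPoly E fun k => m k * a k) ≤ K * lqNorm q (trigPoly E a)

namespace IsMultBound

variable {d q : ℕ} {K K' : ℝ} {m m' : (Fin d → ℤ) → ℂ}

theorem mono (h : IsMultBound q K m) (hK : K ≤ K') : IsMultBound q K' m := fun E a =>
  (h E a).trans (mul_le_mul_of_nonneg_right hK (lqNorm_nonneg _ _))

theorem one : IsMultBound (d := d) q 1 fun _ => 1 := fun E a => by simp

theorem mul (hK : 0 ≤ K) (h : IsMultBound q K m) (h' : IsMultBound q K' m') :
    IsMultBound q (K * K') fun k => m k * m' k := fun E a => by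
  simp only [mul_assoc]
  exact (h E _).trans (mul_le_mul_of_nonneg_left (h' E a) hK)

theorem const_mul (c : ℂ) (h : IsMultBound q K m) :
    IsMultBound q (‖c‖ * K) fun k => c * m k := fun E a => by
  have e : (trigPoly E fun k => c * m k * a k) = c • trigPoly E fun k => m k * a k := by
    simp [trigPoly, Finset.smul_sum, smul_smul, mul_assoc]
  rw [e, lqNorm_smul, mul_assoc]
  exact mul_le_mul_of_nonneg_left (h E a) (norm_nonneg _)

theorem add (hq : 1 ≤ q) (h : IsMultBound q K m) (h' : IsMultBound q K' m') :
    IsMultBound q (K + K') fun k => m k + m' k := fun E a => by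
  have e : (trigPoly E fun k => (m k + m' k) * a k) =
      (trigPoly E fun k => m k * a k) + trigPoly E fun k => m' k * a k := by
    simp [trigPoly, add_mul, add_smul, Finset.sum_add_distrib]
  rw [e, add_mul]
  exact (lqNorm_add_le hq _ _).trans (add_le_add (h E a) (h' E a))

theorem prod {ι : Type*} (s : Finset ι) {K : ι → ℝ} {m : ι → (Fin d → ℤ) → ℂ}
    (hK : ∀ i, 0 ≤ K i) (h : ∀ i, IsMultBound q (K i) (m i)) :
    IsMultBound q (∏ i ∈ s, K i) fun k => ∏ i ∈ s, m i k := by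
  induction s using Finset.induction_on with
  | empty => simpa using one
  | insert i s hi ih =>
    simp only [Finset.prod_insert hi]
    exact mul (hK i) (h i) ih

theorem congr (h : IsMultBound q K m) (e : ∀ k, m k = m' k) : IsMultBound q K m' := by
  rwa [← funext e]

end IsMultBound

theorem exists_isMultBound_halfspace (d k : ℕ) : ∃ C : ℝ, 1 ≤ C ∧ ∀ (j : Fin d) (b : ℤ),
    IsMultBound (2 ^ (k + 1)) C fun k => if b ≤ k j then 1 else 0 := by
  obtain ⟨C, hC, h⟩ := exists_lqNorm_le_lqNorm_add (d := d) k
  refine ⟨C, hC, fun j b E a => ?_⟩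
  set c : Fin d → ℤ := Pi.single j (-b)
  have hc : trigChar c ∈ freqSpan {k : Fin d → ℤ | k j = -b} :=
    Submodule.subset_span ⟨c, by simp [c], rfl⟩
  have hg := mul_mem_freqSpan (U := {k : Fin d → ℤ | 0 ≤ k j})
    (fun k (hk : b ≤ k j) l (hl : l j = -b) => by
      simp only [Set.mem_ofPred_eq, Pi.add_apply]; omega)
    (trigPoly_mem_freqSpan (S := {k : Fin d → ℤ | b ≤ k j}) E
      (a := fun k => (if b ≤ k j then 1 else 0) * a k) fun k hk => by
        by_contra hb; exact hk (by simp [show ¬ b ≤ k j from hb])) hc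
  have hh := mul_mem_freqSpan (U := {k : Fin d → ℤ | k j < 0})
    (fun k (hk : k j < b) l (hl : l j = -b) => by
      simp only [Set.mem_ofPred_eq, Pi.add_apply]; omega)
    (trigPoly_mem_freqSpan (S := {k : Fin d → ℤ | k j < b}) E
      (a := fun k => (if b ≤ k j then 0 else 1) * a k) fun k hk => by
        by_contra hb; exact hk (by simp [not_lt.mp (show ¬ k j < b from hb)])) hc
  have key := h j _ _ hg hh
  rw [← add_mul, lqNorm_mul_trigChar, lqNorm_mul_trigChar] at key
  convert key using 3
  simp only [trigPoly, ← Finset.sum_add_distrib]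
  refine Finset.sum_congr rfl fun k _ => ?_
  split_ifs <;> simp

theorem exists_isMultBound_interval (d k : ℕ) : ∃ C : ℝ, 1 ≤ C ∧
    ∀ (j : Fin d) (σ : ℤ) (lo hi : ℤ), (σ = 1 ∨ σ = -1) →
    IsMultBound (2 ^ (k + 1)) C fun k => if lo ≤ σ * k j ∧ σ * k j ≤ hi then 1 else 0 := by
  obtain ⟨C, hC, h⟩ := exists_isMultBound_halfspace d k
  have h1 : 1 ≤ 2 ^ (k + 1) := Nat.one_le_two_pow
  have hI : ∀ (j : Fin d) (lo hi : ℤ), IsMultBound (2 ^ (k + 1)) (C * (1 + C))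
      fun k => if lo ≤ k j ∧ k j ≤ hi then 1 else 0 := by
    intro j lo hi
    have h2 := (h j lo).mul (by linarith)
      (IsMultBound.one.add h1 ((h j (hi + 1)).const_mul (-1)))
    simp only [norm_neg, norm_one, one_mul] at h2
    refine h2.congr fun k => ?_
    by_cases ha : lo ≤ k j <;> by_cases hb : k j ≤ hi
    · simp [ha, hb, show ¬ hi + 1 ≤ k j by omega]
    · simp [ha, hb, show hi + 1 ≤ k j by omega]
    · simp [ha]
    · simp [ha]
  refine ⟨C * (1 + C), by nlinarith, ?_⟩
  rintro j σ lo hi (rfl | rfl)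
  · simpa using hI j lo hi
  · refine (hI j (-hi) (-lo)).congr fun k => if_congr ?_ rfl rfl
    constructor <;> intro ⟨_, _⟩ <;> constructor <;> linarith

theorem exists_isMultBound_antitone (d k : ℕ) : ∃ C : ℝ, 1 ≤ C ∧
    ∀ (j : Fin d) (σ : ℤ) (lo : ℤ) (w : ℤ → ℝ), (σ = 1 ∨ σ = -1) →
    (∀ x, lo ≤ x → w (x + 1) ≤ w x) → (∀ x, 0 ≤ w x) → ∀ N : ℕ,
    IsMultBound (2 ^ (k + 1)) (C * w lo)
      fun k => if lo ≤ σ * k j ∧ σ * k j ≤ lo + N then (w (σ * k j) : ℂ) else 0 := by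
  obtain ⟨C, hC, h⟩ := exists_isMultBound_interval d k
  have h1 : 1 ≤ 2 ^ (k + 1) := Nat.one_le_two_pow
  refine ⟨C, hC, fun j σ lo w hσ hw hw0 N => ?_⟩
  have key : ∀ N : ℕ, IsMultBound (d := d) (2 ^ (k + 1)) (C * (w lo - w (lo + N)))
      fun k => if lo ≤ σ * k j ∧ σ * k j ≤ lo + N then
        (w (σ * k j) : ℂ) - w (lo + N) else 0 := by
    intro N
    induction N with
    | zero =>
      simp only [Nat.cast_zero, add_zero, sub_self, mul_zero]
      refine ((IsMultBound.one (d := d) (q := 2 ^ (k + 1))).const_mul 0).congr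
        (fun k => ?_) |>.mono (by simp)
      split_ifs with hk
      · rw [le_antisymm hk.2 hk.1]; simp
      · simp
    | succ N ih =>
      have h2 := ih.add h1 ((h j σ lo (lo + N) hσ).const_mul
        ((w (lo + N) - w (lo + N + 1) : ℝ) : ℂ))
      rw [Complex.norm_real, Real.norm_of_nonneg (by linarith [hw (lo + N) (by omega)])] at h2
      refine (h2.congr fun k => ?_).mono (le_of_eq ?_)
      · push_cast
        rw [← add_assoc]
        by_cases ha : lo ≤ σ * k j
        · by_cases hb : σ * k j ≤ lo + N
          · simp [ha, hb, show σ * k j ≤ lo + N + 1 by omega]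
          · by_cases hc : σ * k j = lo + N + 1
            · simp [hc]
            · simp [hb, show ¬ σ * k j ≤ lo + N + 1 by omega]
        · simp [ha]
      · push_cast
        rw [← add_assoc]
        ring
  have h2 := (key N).add h1 ((h j σ lo (lo + N) hσ).const_mul (w (lo + N) : ℂ))
  rw [Complex.norm_real, Real.norm_of_nonneg (hw0 _)] at h2
  refine (h2.congr fun k => ?_).mono (le_of_eq (by ring))
  split_ifs <;> simp

/-- The signed dyadic index: `x` lies in the block `2 ^ (|t| - 1) ≤ |x| < 2 ^ |t|`
of the sign of `t`, where `t` is the index of `x`. -/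
def dyadicIdx (x : ℤ) : ℤ := x.sign * (Nat.size x.natAbs : ℤ)

theorem natAbs_dyadicIdx (x : ℤ) : (dyadicIdx x).natAbs = Nat.size x.natAbs := by
  rw [dyadicIdx, Int.natAbs_mul, Int.natAbs_natCast]
  rcases eq_or_ne x 0 with rfl | h
  · simp
  · rw [Int.natAbs_sign_of_ne_zero h, one_mul]

theorem dyadicIdx_eq_iff {x t : ℤ} (σ : ℤ) (hσ : σ = 1 ∨ σ = -1) (ht : 0 < σ * t) :
    dyadicIdx x = t ↔ (2 ^ (t.natAbs - 1) : ℤ) ≤ σ * x ∧ σ * x ≤ 2 ^ (t.natAbs - 1) +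
      ((2 ^ (t.natAbs - 1) - 1 : ℕ) : ℤ) := by
  obtain ⟨s, hs⟩ : ∃ s, t.natAbs = s + 1 := ⟨t.natAbs - 1, by rcases hσ with rfl | rfl <;> omega⟩
  have e : ((2 ^ (t.natAbs - 1) - 1 : ℕ) : ℤ) = 2 ^ (t.natAbs - 1) - 1 := by
    rw [Nat.cast_sub Nat.one_le_two_pow]; push_cast; rfl
  rw [e, hs, Nat.add_sub_cancel]
  have hp : (0 : ℤ) < 2 ^ s := by positivity
  have hsize : ∀ y : ℕ, Nat.size y = s + 1 ↔ 2 ^ s ≤ y ∧ y < 2 * 2 ^ s := by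
    intro y
    rw [← pow_succ', ← Nat.lt_size, ← Nat.size_le]
    omega
  have h1 := hsize x.natAbs
  have hc : ((2 ^ s : ℕ) : ℤ) = 2 ^ s := by push_cast; rfl
  rw [← hc] at hp ⊢
  set P := 2 ^ s
  constructor
  · intro h
    have h2 := natAbs_dyadicIdx x
    rw [h, hs, eq_comm, h1] at h2
    have h3 : 0 < σ * x := by
      rw [dyadicIdx] at h
      rcases lt_trichotomy x 0 with hx | hx | hx
      · rw [Int.sign_eq_neg_one_of_neg hx] at h
        rcases hσ with rfl | rfl <;> omega
      · simp [hx] at h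
        simp [← h] at ht
      · rw [Int.sign_eq_one_of_pos hx] at h
        rcases hσ with rfl | rfl <;> omega
    rcases hσ with rfl | rfl <;> omega
  · intro h
    have h3 : x.natAbs = σ * x := by rcases hσ with rfl | rfl <;> omega
    have h4 := h1.2 (by omega)
    rw [dyadicIdx, h4]
    have h5 : x.sign = σ := by
      rcases hσ with rfl | rfl
      · exact Int.sign_eq_one_of_pos (by omega)
      · exact Int.sign_eq_neg_one_of_neg (by omega)
    rw [h5]
    rcases hσ with rfl | rfl <;> omega

theorem dyadicIdx_eq_zero_iff {x : ℤ} : dyadicIdx x = 0 ↔ x = 0 := by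
  rw [dyadicIdx, mul_eq_zero, Int.sign_eq_zero_iff_zero, Nat.cast_eq_zero, Nat.size_eq_zero]
  omega

theorem exists_isMultBound_block_coord (d k : ℕ) {r : ℝ} (hr : 0 ≤ r) : ∃ K : ℝ, 1 ≤ K ∧
    ∀ (j : Fin d) (t : ℤ), IsMultBound (2 ^ (k + 1)) (K * (2 : ℝ) ^ (-(r * t.natAbs)))
      fun k => if dyadicIdx (k j) = t then
        ((if k j = 0 then 1 else |(k j : ℝ)| ^ (-r) : ℝ) : ℂ) else 0 := by
  obtain ⟨C, hC, h⟩ := exists_isMultBound_antitone d k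
  have h2r : (1 : ℝ) ≤ 2 ^ r := one_le_rpow one_le_two hr
  refine ⟨C * 2 ^ r, by nlinarith, fun j t => ?_⟩
  rcases eq_or_ne t 0 with rfl | ht
  · have h0 := h j 1 0 (fun _ => 1) (Or.inl rfl) (fun _ _ => le_rfl) (fun _ => zero_le_one) 0
    simp only [one_mul, Nat.cast_zero, zero_add, mul_one] at h0
    refine (h0.congr fun k => ?_).mono (by simp; nlinarith)
    by_cases hk : k j = 0
    · simp [hk, dyadicIdx]
    · rw [if_neg, if_neg (mt dyadicIdx_eq_zero_iff.1 hk)]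
      omega
  · obtain ⟨σ, hσ, hσt⟩ : ∃ σ : ℤ, (σ = 1 ∨ σ = -1) ∧ 0 < σ * t := by
      rcases lt_or_gt_of_ne ht with h | h
      · exact ⟨-1, Or.inr rfl, by omega⟩
      · exact ⟨1, Or.inl rfl, by omega⟩
    obtain ⟨s, hs⟩ : ∃ s, t.natAbs = s + 1 := ⟨t.natAbs - 1, by omega⟩
    have h0 := h j σ (2 ^ (t.natAbs - 1)) (fun x => |(x : ℝ)| ^ (-r)) hσ (fun x hx => ?_)
      (fun x => by positivity) (2 ^ (t.natAbs - 1) - 1)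
    · refine (h0.congr fun k => ?_).mono (le_of_eq ?_)
      · by_cases hk : dyadicIdx (k j) = t
        · have hk0 : k j ≠ 0 := by
            rintro h0
            rw [h0] at hk
            simp [dyadicIdx] at hk
            exact ht hk.symm
          rw [if_pos ((dyadicIdx_eq_iff σ hσ hσt).1 hk), if_pos hk, if_neg hk0]
          rcases hσ with rfl | rfl <;> simp
        · rw [if_neg (mt (dyadicIdx_eq_iff σ hσ hσt).2 hk), if_neg hk]
      · rw [hs, Nat.add_sub_cancel, mul_assoc, ← rpow_add two_pos]
        push_cast
        rw [abs_of_pos (by positivity), ← rpow_natCast, ← rpow_mul two_pos.le]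
        congr 2
        ring
    · have hx0 : (0 : ℝ) < x := by
        have : (0 : ℤ) < 2 ^ (t.natAbs - 1) := by positivity
        exact_mod_cast this.trans_le hx
      push_cast
      rw [abs_of_pos hx0, abs_of_pos (by linarith)]
      exact rpow_le_rpow_of_nonpos hx0 (by linarith) (by linarith)

/-- The block weights `w` restricted to a dyadic block are bounded multipliers in `L_q`. -/
theorem exists_isMultBound_block (d k : ℕ) {r : ℝ} (hr : 0 ≤ r) : ∃ K : ℝ, 1 ≤ K ∧
    ∀ t : Fin d → ℤ, IsMultBound (2 ^ (k + 1)) (K * (2 : ℝ) ^ (-(r * ∑ j, (t j).natAbs)))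
      fun k => if ∀ j, dyadicIdx (k j) = t j then (wBern d r k : ℂ) else 0 := by
  obtain ⟨K, hK, h⟩ := exists_isMultBound_block_coord d k hr
  refine ⟨K ^ d, one_le_pow₀ hK, fun t => ?_⟩
  have h1 := IsMultBound.prod Finset.univ (fun j => by positivity) fun j => h j (t j)
  refine (h1.congr fun k => ?_).mono (le_of_eq ?_)
  · split_ifs with hk
    · simp only [hk, if_true, wBern]
      push_cast
      rfl
    · push Not at hk
      obtain ⟨j, hj⟩ := hk
      exact Finset.prod_eq_zero (Finset.mem_univ j) (if_neg hj)
  · rw [Finset.prod_mul_distrib, Finset.prod_const, Finset.card_univ, Fintype.card_fin,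
      ← rpow_sum_of_pos two_pos]
    push_cast
    rw [Finset.mul_sum, Finset.sum_neg_distrib]

theorem mem_hypCross_iff {d n : ℕ} {k : Fin d → ℤ} :
    k ∈ hypCross d n ↔ ∑ j, (dyadicIdx (k j)).natAbs ≤ n := by
  have hrho : ∀ s : Fin d → ℕ, inRho s k ↔ ∀ j, (dyadicIdx (k j)).natAbs = s j := by
    intro s
    refine forall_congr' fun j => ?_
    rw [natAbs_dyadicIdx]
    have hc : |k j| = ((k j).natAbs : ℤ) := Int.abs_eq_natAbs _
    rw [hc]
    set y := (k j).natAbs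
    rcases s j with _ | s
    · simp only [pow_zero, Nat.size_eq_zero]
      omega
    · have e : (2 ^ (s + 1) / 2 : ℤ) = ((2 ^ s : ℕ) : ℤ) := by
        rw [pow_succ]; push_cast; omega
      have e2 : (2 ^ (s + 1) : ℤ) = ((2 ^ (s + 1) : ℕ) : ℤ) := by push_cast; rfl
      rw [e, e2, Nat.cast_le, Nat.cast_lt, ← Nat.lt_size, ← Nat.size_le]
      omega
  rw [hypCross, Finset.mem_filter, Finset.mem_Icc]
  constructor
  · rintro ⟨-, s, hs, h⟩
    rw [hrho] at h
    simpa [h] using hs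
  · intro h
    have hk : ∀ j, |k j| ≤ 2 ^ n := by
      intro j
      have h1 : (k j).natAbs.size ≤ n := by
        rw [← natAbs_dyadicIdx]
        exact (Finset.single_le_sum (f := fun j => (dyadicIdx (k j)).natAbs)
          (fun _ _ => Nat.zero_le _) (Finset.mem_univ j)).trans h
      rw [Nat.size_le] at h1
      rw [Int.abs_eq_natAbs]
      exact_mod_cast h1.le
    exact ⟨⟨fun j => (abs_le.1 (hk j)).1, fun j => (abs_le.1 (hk j)).2⟩,
      fun j => (dyadicIdx (k j)).natAbs, h, (hrho _).2 fun _ => rfl⟩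

theorem mem_layer_iff {d n : ℕ} (hn : 1 ≤ n) {k : Fin d → ℤ} :
    k ∈ hypCross d n \ hypCross d (n - 1) ↔ ∑ j, (dyadicIdx (k j)).natAbs = n := by
  rw [Finset.mem_sdiff, mem_hypCross_iff, mem_hypCross_iff]
  omega

/-- The signed block indices of the `n`-th dyadic layer. -/
def layerIdx (d n : ℕ) : Finset (Fin d → ℤ) :=
  (Fintype.piFinset fun _ => Finset.Icc (-(n : ℤ)) n).filter fun t => ∑ j, (t j).natAbs = n

theorem mem_layerIdx {d n : ℕ} {t : Fin d → ℤ} :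
    t ∈ layerIdx d n ↔ ∑ j, (t j).natAbs = n := by
  rw [layerIdx, Finset.mem_filter, and_iff_right_iff_imp]
  intro h
  rw [Fintype.mem_piFinset]
  intro j
  have := Finset.single_le_sum (f := fun j => (t j).natAbs)
    (fun _ _ => Nat.zero_le _) (Finset.mem_univ j)
  rw [Finset.mem_Icc]
  omega

theorem card_layerIdx_le {d n : ℕ} (hd : 1 ≤ d) (hn : 1 ≤ n) :
    (layerIdx d n).card ≤ 2 * 3 ^ d * n ^ (d - 1) := by
  obtain ⟨d, rfl⟩ : ∃ d', d = d' + 1 := ⟨d - 1, by omega⟩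
  rw [Nat.add_sub_cancel]
  have h : (layerIdx (d + 1) n).card ≤
      ((Finset.univ : Finset Bool) ×ˢ
        Fintype.piFinset fun _ : Fin d => Finset.Icc (-(n : ℤ)) n).card := by
    refine Finset.card_le_card_of_injOn (fun t => (decide (0 ≤ t 0), Fin.tail t)) ?_ ?_
    · intro t ht
      have ht' := Finset.mem_coe.1 ht
      rw [layerIdx, Finset.mem_filter, Fintype.mem_piFinset] at ht'
      simp only [Finset.coe_product, Set.mem_prod, Finset.mem_coe, Finset.mem_univ, true_and,
        Fintype.mem_piFinset]
      exact fun j => ht'.1 _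
    · intro t ht u hu htu
      have ht' := mem_layerIdx.1 (Finset.mem_coe.1 ht)
      have hu' := mem_layerIdx.1 (Finset.mem_coe.1 hu)
      simp only [Prod.mk.injEq, decide_eq_decide] at htu
      have htail : ∀ j : Fin d, t j.succ = u j.succ := fun j => congrFun htu.2 j
      rw [Fin.sum_univ_succ] at ht' hu'
      simp only [htail] at ht'
      funext j
      refine Fin.cases ?_ (fun j => htail j) j
      have := htu.1
      by_cases h0 : 0 ≤ t 0
      · have := this.1 h0; omega
      · have := mt this.2 h0; omega
  refine h.trans ?_
  rw [Finset.card_product, Fintype.card_piFinset]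
  simp only [Finset.card_univ, Fintype.card_bool, Int.card_Icc, Finset.prod_const,
    Fintype.card_fin]
  have e : ((n : ℤ) + 1 - -(n : ℤ)).toNat = 2 * n + 1 := by omega
  rw [e, pow_succ, mul_assoc, mul_assoc]
  refine Nat.mul_le_mul_left 2 ?_
  calc (2 * n + 1) ^ d ≤ (3 * n) ^ d := Nat.pow_le_pow_left (by omega) d
    _ = 3 ^ d * n ^ d := mul_pow _ _ _
    _ ≤ 3 ^ d * (3 * n ^ d) := Nat.mul_le_mul_left _ (by omega)

theorem dyadicIdx_neg (x : ℤ) : dyadicIdx (-x) = -dyadicIdx x := by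
  simp [dyadicIdx, Int.sign_neg]

theorem exists_boxes_pos (s : ℕ) : ∃ A B : Finset ℤ, B.Nonempty ∧ A.card ≤ 3 * B.card ∧
    (∀ x, dyadicIdx x = s + 1 → ∀ b ∈ B, x - b ∈ A) ∧
    ∀ a ∈ A, ∀ b ∈ B, |dyadicIdx (a + b) - (s + 1)| ≤ 1 ∧ |a + b| < 2 ^ (s + 2) := by
  set P : ℕ := 2 ^ s with hP
  have hP1 : 1 ≤ P := Nat.one_le_two_pow
  have hmem : ∀ x : ℤ, dyadicIdx x = s + 1 ↔ (P : ℤ) ≤ x ∧ x < 2 * P := by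
    intro x
    have := dyadicIdx_eq_iff (x := x) (t := s + 1) 1 (Or.inl rfl) (by omega)
    rw [this]
    have e : ((s : ℤ) + 1).natAbs - 1 = s := by omega
    have e2 : ((2 ^ s - 1 : ℕ) : ℤ) = P - 1 := by rw [Nat.cast_sub hP1]; simp [hP]
    have e3 : (2 ^ s : ℤ) = P := by simp [hP]
    rw [e, e2, e3]
    omega
  obtain ⟨l, hl1, hlP, hl⟩ : ∃ l : ℕ, 1 ≤ l ∧ P ≤ 2 * l ∧ (l = 1 ∧ P = 1 ∨ P = 2 * l) := by
    rcases s with _ | s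
    · exact ⟨1, le_rfl, by simp [hP], by simp [hP]⟩
    · exact ⟨2 ^ s, Nat.one_le_two_pow, by simp [hP, pow_succ, mul_comm],
        Or.inr (by simp [hP, pow_succ, mul_comm])⟩
  refine ⟨Finset.Icc (P - (l - 1)) (2 * P - 1), Finset.Icc 0 (l - 1), ⟨0, ?_⟩, ?_, ?_, ?_⟩
  · rw [Finset.mem_Icc]; omega
  · simp only [Int.card_Icc]; omega
  · intro x hx b hb
    rw [hmem] at hx
    rw [Finset.mem_Icc] at hb ⊢
    omega
  · intro a ha b hb
    rw [Finset.mem_Icc] at ha hb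
    have h4 : (2 ^ (s + 2) : ℤ) = 4 * P := by rw [pow_add]; push_cast [hP]; ring
    rw [h4]
    have h0 : 0 < a + b := by omega
    have h5 : a + b < 4 * P := by omega
    refine ⟨?_, by rw [abs_of_pos h0]; exact h5⟩
    rw [dyadicIdx, Int.sign_eq_one_of_pos h0, one_mul]
    have h6 : (a + b).natAbs.size ≤ s + 2 := by
      rw [Nat.size_le, pow_add]; omega
    have h7 : s ≤ (a + b).natAbs.size := by
      rcases s with _ | s
      · omega
      · rw [Nat.succ_le_iff, Nat.lt_size]
        have : P = 2 * 2 ^ s := by rw [hP, pow_succ, mul_comm]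
        omega
    rw [abs_le]
    omega

theorem exists_boxes_one (t : ℤ) : ∃ A B : Finset ℤ, B.Nonempty ∧ A.card ≤ 3 * B.card ∧
    (∀ x, dyadicIdx x = t → ∀ b ∈ B, x - b ∈ A) ∧
    ∀ a ∈ A, ∀ b ∈ B, |dyadicIdx (a + b) - t| ≤ 1 ∧ |a + b| < 2 ^ (t.natAbs + 1) := by
  rcases lt_trichotomy t 0 with h | rfl | h
  · obtain ⟨s, rfl⟩ : ∃ s : ℕ, t = -(s + 1) := ⟨(-t - 1).toNat, by omega⟩
    obtain ⟨A, B, hB, hAB, h1, h2⟩ := exists_boxes_pos s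
    refine ⟨A.map (Equiv.neg ℤ).toEmbedding, B.map (Equiv.neg ℤ).toEmbedding, by simpa using hB,
      by simpa using hAB, ?_, ?_⟩
    · intro x hx b hb
      rw [Finset.mem_map_equiv] at hb ⊢
      have := h1 (-x) (by rw [dyadicIdx_neg, hx, neg_neg]) _ hb
      convert this using 1
      simp
      ring
    · intro a ha b hb
      rw [Finset.mem_map_equiv] at ha hb
      have := h2 _ ha _ hb
      simp only [Equiv.neg_symm, Equiv.neg_apply] at this
      rw [← neg_add, dyadicIdx_neg, abs_neg] at this
      rw [← abs_neg]
      convert this using 3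
      · ring
      · omega
  · refine ⟨{0}, {0}, by simp, by simp, ?_, ?_⟩
    · intro x hx b hb
      rw [dyadicIdx_eq_zero_iff] at hx
      simp_all
    · simp [dyadicIdx]
  · obtain ⟨s, rfl⟩ : ∃ s : ℕ, t = s + 1 := ⟨(t - 1).toNat, by omega⟩
    obtain ⟨A, B, hB, hAB, h1, h2⟩ := exists_boxes_pos s
    refine ⟨A, B, hB, hAB, h1, fun a ha b hb => ?_⟩
    convert h2 a ha b hb using 3
    omega

theorem exists_boxes {d : ℕ} (t : Fin d → ℤ) : ∃ A B : Finset (Fin d → ℤ), B.Nonempty ∧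
    A.card ≤ 3 ^ d * B.card ∧
    (∀ k, (∀ j, dyadicIdx (k j) = t j) → ∀ b ∈ B, k - b ∈ A) ∧
    ∀ a ∈ A, ∀ b ∈ B, ∀ j, |dyadicIdx ((a + b) j) - t j| ≤ 1 ∧
      |(a + b) j| < 2 ^ ((t j).natAbs + 1) := by
  choose A B hB hAB h1 h2 using exists_boxes_one
  refine ⟨Fintype.piFinset fun j => A (t j), Fintype.piFinset fun j => B (t j), ?_, ?_, ?_, ?_⟩
  · exact Fintype.piFinset_nonempty.2 fun j => hB _
  · rw [Fintype.card_piFinset, Fintype.card_piFinset]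
    calc ∏ j, (A (t j)).card ≤ ∏ j, 3 * (B (t j)).card :=
          Finset.prod_le_prod' fun j _ => hAB _
      _ = _ := by simp [Finset.prod_mul_distrib]
  · intro k hk b hb
    rw [Fintype.mem_piFinset] at hb ⊢
    exact fun j => h1 _ _ (hk j) _ (hb j)
  · intro a ha b hb j
    rw [Fintype.mem_piFinset] at ha hb
    exact h2 _ _ (ha j) _ (hb j)

/-- The outer box of the de la Vallée-Poussin kernel of a dyadic block. -/
def outerBox {d : ℕ} (t : Fin d → ℤ) : Finset (Fin d → ℤ) := (exists_boxes t).choose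

/-- The averaging box of the de la Vallée-Poussin kernel of a dyadic block. -/
def innerBox {d : ℕ} (t : Fin d → ℤ) : Finset (Fin d → ℤ) := (exists_boxes t).choose_spec.choose

theorem boxes_spec {d : ℕ} (t : Fin d → ℤ) : (innerBox t).Nonempty ∧
    (outerBox t).card ≤ 3 ^ d * (innerBox t).card ∧
    (∀ k, (∀ j, dyadicIdx (k j) = t j) → ∀ b ∈ innerBox t, k - b ∈ outerBox t) ∧
    ∀ a ∈ outerBox t, ∀ b ∈ innerBox t, ∀ j, |dyadicIdx ((a + b) j) - t j| ≤ 1 ∧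
      |(a + b) j| < 2 ^ ((t j).natAbs + 1) := (exists_boxes t).choose_spec.choose_spec

/-- The frequencies of the de la Vallée-Poussin kernel of a dyadic block. -/
def vpSupp {d : ℕ} (t : Fin d → ℤ) : Finset (Fin d → ℤ) :=
  Finset.image₂ (· + ·) (outerBox t) (innerBox t)

/-- The coefficients of the de la Vallée-Poussin kernel of a dyadic block. -/
def vpWeight {d : ℕ} (t k : Fin d → ℤ) : ℝ :=
  ((innerBox t).filter fun b => k - b ∈ outerBox t).card / (innerBox t).card

theorem vpWeight_nonneg {d : ℕ} (t k : Fin d → ℤ) : 0 ≤ vpWeight t k := by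
  unfold vpWeight; positivity

theorem vpWeight_le_one {d : ℕ} (t k : Fin d → ℤ) : vpWeight t k ≤ 1 :=
  div_le_one_of_le₀ (by exact_mod_cast Finset.card_filter_le _ _) (by positivity)

theorem vpWeight_eq_one {d : ℕ} {t k : Fin d → ℤ} (h : ∀ j, dyadicIdx (k j) = t j) :
    vpWeight t k = 1 := by
  have hB := (boxes_spec t).1
  rw [vpWeight, Finset.filter_true_of_mem ((boxes_spec t).2.2.1 k h), div_self]
  exact_mod_cast hB.card_pos.ne'

theorem mem_vpSupp {d : ℕ} {t k : Fin d → ℤ} (h : ∀ j, dyadicIdx (k j) = t j) :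
    k ∈ vpSupp t := by
  obtain ⟨b, hb⟩ := (boxes_spec t).1
  exact Finset.mem_image₂.2 ⟨k - b, (boxes_spec t).2.2.1 k h b hb, b, hb, sub_add_cancel k b⟩

theorem vpSupp_spec {d : ℕ} {t k : Fin d → ℤ} (h : k ∈ vpSupp t) (j : Fin d) :
    |dyadicIdx (k j) - t j| ≤ 1 ∧ |k j| < 2 ^ ((t j).natAbs + 1) := by
  obtain ⟨a, ha, b, hb, rfl⟩ := Finset.mem_image₂.1 h
  exact (boxes_spec t).2.2.2 a ha b hb j

theorem card_filter_vpSupp_le {d : ℕ} (T : Finset (Fin d → ℤ)) (k : Fin d → ℤ) :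
    (T.filter fun t => k ∈ vpSupp t).card ≤ 3 ^ d := by
  have : (T.filter fun t => k ∈ vpSupp t) ⊆
      Fintype.piFinset fun j => Finset.Icc (dyadicIdx (k j) - 1) (dyadicIdx (k j) + 1) := by
    intro t ht
    rw [Fintype.mem_piFinset]
    intro j
    have := abs_le.1 (vpSupp_spec (Finset.mem_filter.1 ht).2 j).1
    rw [Finset.mem_Icc]
    omega
  refine (Finset.card_le_card this).trans (le_of_eq ?_)
  rw [Fintype.card_piFinset]
  have : ∀ j, (Finset.Icc (dyadicIdx (k j) - 1) (dyadicIdx (k j) + 1)).card = 3 := by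
    intro j; rw [Int.card_Icc]; omega
  simp [this]

/-- The frequencies of all de la Vallée-Poussin kernels of a dyadic layer. -/
def layerSupp (d n : ℕ) : Finset (Fin d → ℤ) := (layerIdx d n).biUnion vpSupp

theorem abs_lt_of_mem_layerSupp {d n : ℕ} {k : Fin d → ℤ} (h : k ∈ layerSupp d n) (j : Fin d) :
    |k j| < 2 ^ (n + 1) := by
  obtain ⟨t, ht, hk⟩ := Finset.mem_biUnion.1 h
  refine (vpSupp_spec hk j).2.trans_le (pow_le_pow_right₀ (by norm_num) ?_)
  have := Finset.single_le_sum (f := fun j => (t j).natAbs)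
    (fun _ _ => Nat.zero_le _) (Finset.mem_univ j)
  have := mem_layerIdx.1 ht
  omega

theorem card_layerSupp_le {d n : ℕ} (hd : 1 ≤ d) (hn : 1 ≤ n) :
    (layerSupp d n).card ≤ 2 * 12 ^ d * 2 ^ n * n ^ (d - 1) := by
  have h1 : ∀ t ∈ layerIdx d n, (vpSupp t).card ≤ 4 ^ d * 2 ^ n := by
    intro t ht
    have : vpSupp t ⊆ Fintype.piFinset fun j =>
        Finset.Ioo (-(2 ^ ((t j).natAbs + 1)) : ℤ) (2 ^ ((t j).natAbs + 1)) := by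
      intro k hk
      rw [Fintype.mem_piFinset]
      intro j
      rw [Finset.mem_Ioo]
      exact abs_lt.1 (vpSupp_spec hk j).2
    refine (Finset.card_le_card this).trans ?_
    rw [Fintype.card_piFinset]
    calc ∏ j, (Finset.Ioo (-(2 ^ ((t j).natAbs + 1)) : ℤ) (2 ^ ((t j).natAbs + 1))).card
        ≤ ∏ j, 4 * 2 ^ (t j).natAbs := by
          refine Finset.prod_le_prod' fun j _ => ?_
          rw [Int.card_Ioo]
          have : (2 ^ ((t j).natAbs + 1) : ℤ) = 2 * ((2 ^ (t j).natAbs : ℕ) : ℤ) := by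
            push_cast; ring
          rw [this]
          omega
      _ = 4 ^ d * 2 ^ n := by
          rw [Finset.prod_mul_distrib, Finset.prod_pow_eq_pow_sum, mem_layerIdx.1 ht]
          simp
  calc (layerSupp d n).card ≤ ∑ t ∈ layerIdx d n, (vpSupp t).card := Finset.card_biUnion_le
    _ ≤ (layerIdx d n).card * (4 ^ d * 2 ^ n) := by
        rw [← smul_eq_mul]; exact Finset.sum_le_card_nsmul _ _ _ h1
    _ ≤ 2 * 3 ^ d * n ^ (d - 1) * (4 ^ d * 2 ^ n) :=
        Nat.mul_le_mul_right _ (card_layerIdx_le hd hn)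
    _ = 2 * 12 ^ d * 2 ^ n * n ^ (d - 1) := by
        rw [show 12 = 3 * 4 by norm_num, mul_pow]; ring

/-- The de la Vallée-Poussin mean of `f` associated with a dyadic block. -/
def vpOp {d : ℕ} (t : Fin d → ℤ) (f : Torus d → ℂ) : C(Torus d, ℂ) :=
  trigPoly (vpSupp t) fun k => (vpWeight t k : ℂ) * fCoeff f k

theorem fCoeff_conj_trigChar_mul {d : ℕ} (f : Torus d → ℂ) (a b : Fin d → ℤ) :
    fCoeff (fun x => conj (trigChar a x) * f x) b = fCoeff f (a + b) := by
  simp only [fCoeff, trigChar_add, ContinuousMap.mul_apply, map_mul]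
  congr 2
  ext x
  ring

theorem integrable_conj_continuousMap_mul {d : ℕ} {f : Torus d → ℂ} (hf : Integrable f)
    (g : C(Torus d, ℂ)) : Integrable fun x => conj (g x) * f x := by
  obtain ⟨C, hC⟩ := (isCompact_range g.continuous).isBounded.exists_norm_le
  refine hf.bdd_mul (c := C) ?_ ?_
  · exact (Complex.continuous_conj.comp g.continuous).aestronglyMeasurable
  · exact Filter.Eventually.of_forall fun x => by simpa using hC _ ⟨x, rfl⟩

theorem integral_conj_trigPoly_mul_trigPoly_mul {d : ℕ} (A B : Finset (Fin d → ℤ))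
    (α β : (Fin d → ℤ) → ℂ) {f : Torus d → ℂ} (hf : Integrable f) :
    ∫ y, conj (trigPoly A α y) * (conj (trigPoly B β y) * f y) =
      ((2 * π : ℝ) ^ d : ℂ) * ∑ a ∈ A, ∑ b ∈ B, conj (α a) * conj (β b) * fCoeff f (a + b) := by
  have hc : ((2 * π : ℝ) ^ d : ℂ) ≠ 0 := by exact_mod_cast (torusMass_pos d).ne'
  rw [integral_conj_trigPoly_mul A α (integrable_conj_continuousMap_mul hf _)]
  congr 1
  refine Finset.sum_congr rfl fun a _ => ?_
  simp only [mul_assoc]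
  rw [← Finset.mul_sum]
  congr 1
  rw [← mul_right_inj' hc, ← integral_conj_trigChar_mul_eq]
  simp only [mul_left_comm (conj (trigChar a _))]
  rw [integral_conj_trigPoly_mul B β (integrable_conj_trigChar_mul hf a)]
  simp only [fCoeff_conj_trigChar_mul]

theorem card_mul_vpOp_apply {d : ℕ} (t : Fin d → ℤ) (f : Torus d → ℂ) (x : Torus d) :
    ((innerBox t).card : ℂ) * vpOp t f x =
      ∑ a ∈ outerBox t, ∑ b ∈ innerBox t, trigChar a x * trigChar b x * fCoeff f (a + b) := by
  have hB : ((innerBox t).card : ℂ) ≠ 0 := by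
    exact_mod_cast (boxes_spec t).1.card_pos.ne'
  rw [vpOp, trigPoly_apply, Finset.mul_sum]
  have h1 : ∀ k, ((innerBox t).card : ℂ) * ((vpWeight t k : ℂ) * fCoeff f k * trigChar k x) =
      ∑ b ∈ innerBox t, if k - b ∈ outerBox t then fCoeff f k * trigChar k x else 0 := by
    intro k
    rw [← Finset.sum_filter, Finset.sum_const, nsmul_eq_mul, vpWeight]
    push_cast
    field_simp
  simp only [h1]
  rw [Finset.sum_comm, Finset.sum_comm (s := outerBox t)]
  refine Finset.sum_congr rfl fun b hb => ?_
  rw [← Finset.sum_filter]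
  symm
  refine Finset.sum_bij (fun a _ => a + b) ?_ ?_ ?_ ?_
  · intro a ha
    rw [Finset.mem_filter, add_sub_cancel_right]
    exact ⟨Finset.mem_image₂_of_mem ha hb, ha⟩
  · intro a _ a' _ h
    exact add_right_cancel h
  · intro k hk
    exact ⟨k - b, (Finset.mem_filter.1 hk).2, sub_add_cancel k b⟩
  · intro a _
    rw [trigChar_add, ContinuousMap.mul_apply]
    ring

theorem norm_vpOp_apply_le {d : ℕ} (t : Fin d → ℤ) {f : Torus d → ℂ} (hf : Integrable f)
    {u : ℝ} (hu : ∀ᵐ x, ‖f x‖ ≤ u) (hu0 : 0 ≤ u) (x : Torus d) : ‖vpOp t f x‖ ≤ 3 ^ d * u := by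
  have hB : (0 : ℝ) < (innerBox t).card := by
    exact_mod_cast (boxes_spec t).1.card_pos
  have hAB : ((outerBox t).card : ℝ) ≤ 3 ^ d * (innerBox t).card := by
    exact_mod_cast (boxes_spec t).2.1
  have hc := torusMass_pos d
  set F := trigPoly (outerBox t) fun a => conj (trigChar a x)
  set G := trigPoly (innerBox t) fun b => conj (trigChar b x)
  have h := integral_conj_trigPoly_mul_trigPoly_mul (outerBox t) (innerBox t)
    (fun a => conj (trigChar a x)) (fun b => conj (trigChar b x)) hf
  simp only [Complex.conj_conj] at h
  rw [← card_mul_vpOp_apply] at h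
  have hsq : ∀ f : C(Torus d, ℂ), Integrable fun x => ‖f x‖ ^ 2 := fun f =>
    (memLp_of_continuousMap 2 f).integrable_norm_pow two_ne_zero
  have hF : ∫ y, ‖F y‖ ^ 2 = (2 * π) ^ d * (outerBox t).card := by
    rw [integral_norm_trigPoly_sq]; simp [norm_trigChar]
  have hG : ∫ y, ‖G y‖ ^ 2 = (2 * π) ^ d * (innerBox t).card := by
    rw [integral_norm_trigPoly_sq]; simp [norm_trigChar]
  have hle : ‖∫ y, conj (F y) * (conj (G y) * f y)‖ ≤
      ∫ y, (‖F y‖ ^ 2 + ‖G y‖ ^ 2) * (u / 2) := by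
    refine norm_integral_le_of_norm_le (((hsq F).add (hsq G)).mul_const _) ?_
    filter_upwards [hu] with y hy
    rw [norm_mul, norm_mul, RCLike.norm_conj, RCLike.norm_conj, ← mul_assoc]
    calc ‖F y‖ * ‖G y‖ * ‖f y‖ ≤ ‖F y‖ * ‖G y‖ * u := by gcongr
      _ ≤ _ := by nlinarith [two_mul_le_add_sq ‖F y‖ ‖G y‖]
  have h3 : (1 : ℝ) ≤ 3 ^ d := one_le_pow₀ (by norm_num)
  rw [integral_mul_const, integral_add (hsq F) (hsq G), hF, hG, h, norm_mul, norm_mul, norm_pow,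
    Complex.norm_real, Complex.norm_natCast, Real.norm_of_nonneg (by positivity)] at hle
  have h5 : (2 * π) ^ d * ((innerBox t).card * ‖vpOp t f x‖) ≤
      (2 * π) ^ d * ((innerBox t).card * (3 ^ d * u)) := by
    refine hle.trans ?_
    rw [← mul_add, mul_assoc]
    refine mul_le_mul_of_nonneg_left ?_ hc.le
    nlinarith [mul_nonneg hB.le hu0]
  exact le_of_mul_le_mul_left (le_of_mul_le_mul_left h5 hc) hB

theorem sum_layer_sum_vpSupp_le {d n : ℕ} {a : (Fin d → ℤ) → ℝ} (ha : ∀ k, 0 ≤ a k) :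
    ∑ t ∈ layerIdx d n, ∑ k ∈ vpSupp t, a k ≤ 3 ^ d * ∑ k ∈ layerSupp d n, a k := by
  have h1 : ∀ t ∈ layerIdx d n, ∑ k ∈ vpSupp t, a k =
      ∑ k ∈ layerSupp d n, if k ∈ vpSupp t then a k else 0 := by
    intro t ht
    rw [← Finset.sum_filter]
    refine Finset.sum_congr ?_ fun _ _ => rfl
    ext k
    rw [Finset.mem_filter]
    exact ⟨fun h => ⟨Finset.mem_biUnion.2 ⟨t, ht, h⟩, h⟩, fun h => h.2⟩
  rw [Finset.sum_congr rfl h1, Finset.sum_comm, Finset.mul_sum]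
  refine Finset.sum_le_sum fun k _ => ?_
  rw [← Finset.sum_filter, Finset.sum_const, nsmul_eq_mul]
  refine mul_le_mul_of_nonneg_right ?_ (ha k)
  exact_mod_cast card_filter_vpSupp_le _ k

theorem sum_integral_norm_vpOp_sq_le {d n : ℕ} {f : Torus d → ℂ} (hf : MemLp f 2) :
    ∑ t ∈ layerIdx d n, ∫ x, ‖vpOp t f x‖ ^ 2 ≤ 3 ^ d * ∫ x, ‖f x‖ ^ 2 := by
  calc ∑ t ∈ layerIdx d n, ∫ x, ‖vpOp t f x‖ ^ 2
      ≤ ∑ t ∈ layerIdx d n, (2 * π) ^ d * ∑ k ∈ vpSupp t, ‖fCoeff f k‖ ^ 2 := by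
        refine Finset.sum_le_sum fun t _ => ?_
        rw [vpOp, integral_norm_trigPoly_sq]
        refine mul_le_mul_of_nonneg_left (Finset.sum_le_sum fun k _ => ?_) (torusMass_pos d).le
        rw [norm_mul, Complex.norm_real, Real.norm_of_nonneg (vpWeight_nonneg _ _)]
        exact pow_le_pow_left₀ (by positivity [vpWeight_nonneg t k])
          (mul_le_of_le_one_left (norm_nonneg _) (vpWeight_le_one _ _)) 2
    _ ≤ (2 * π) ^ d * (3 ^ d * ∑ k ∈ layerSupp d n, ‖fCoeff f k‖ ^ 2) := by
        rw [← Finset.mul_sum]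
        exact mul_le_mul_of_nonneg_left (sum_layer_sum_vpSupp_le fun k => by positivity)
          (torusMass_pos d).le
    _ ≤ 3 ^ d * ∫ x, ‖f x‖ ^ 2 := by
        rw [mul_left_comm]
        exact mul_le_mul_of_nonneg_left (sum_norm_fCoeff_sq_le _ hf) (by positivity)

/-- The representative of `SDeltaW` as a trigonometric polynomial. -/
def layerOp {d : ℕ} (r : ℝ) (n : ℕ) (f : Torus d → ℂ) : C(Torus d, ℂ) :=
  trigPoly (hypCross d n \ hypCross d (n - 1)) fun k => (wBern d r k : ℂ) * fCoeff f k

/-- The part of `layerOp` with frequencies in a single dyadic block. -/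
def blockOp {d : ℕ} (r : ℝ) (t : Fin d → ℤ) (f : Torus d → ℂ) : C(Torus d, ℂ) :=
  trigPoly (vpSupp t) fun k => (if ∀ j, dyadicIdx (k j) = t j then (wBern d r k : ℂ) else 0) *
    ((vpWeight t k : ℂ) * fCoeff f k)

theorem trigPoly_add {d : ℕ} (E : Finset (Fin d → ℤ)) (a b : (Fin d → ℤ) → ℂ) :
    trigPoly E (fun k => a k + b k) = trigPoly E a + trigPoly E b := by
  simp [trigPoly, add_smul, Finset.sum_add_distrib]

theorem trigPoly_sum {d : ℕ} {ι : Type*} (s : Finset ι) (E : Finset (Fin d → ℤ))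
    (a : ι → (Fin d → ℤ) → ℂ) :
    trigPoly E (fun k => ∑ i ∈ s, a i k) = ∑ i ∈ s, trigPoly E (a i) := by
  simp only [trigPoly, Finset.sum_smul]
  exact Finset.sum_comm

theorem trigPoly_congr_subset {d : ℕ} {E F : Finset (Fin d → ℤ)} (hEF : E ⊆ F)
    {a b : (Fin d → ℤ) → ℂ} (h : ∀ k ∈ E, a k = b k) (h0 : ∀ k ∈ F, k ∉ E → b k = 0) :
    trigPoly E a = trigPoly F b := by
  rw [trigPoly, trigPoly, ← Finset.sum_subset hEF fun k hk hk' => by rw [h0 k hk hk', zero_smul]]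
  exact Finset.sum_congr rfl fun k hk => by rw [h k hk]

theorem vpSupp_subset_layerSupp {d n : ℕ} {t : Fin d → ℤ} (ht : t ∈ layerIdx d n) :
    vpSupp t ⊆ layerSupp d n := fun _ h => Finset.mem_biUnion.2 ⟨t, ht, h⟩

theorem layer_subset_layerSupp {d n : ℕ} (hn : 1 ≤ n) :
    hypCross d n \ hypCross d (n - 1) ⊆ layerSupp d n := by
  intro k hk
  rw [mem_layer_iff hn] at hk
  exact Finset.mem_biUnion.2 ⟨fun j => dyadicIdx (k j), mem_layerIdx.2 hk, mem_vpSupp fun _ => rfl⟩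

theorem layerOp_eq_sum_blockOp {d n : ℕ} (hn : 1 ≤ n) (r : ℝ) (f : Torus d → ℂ) :
    layerOp r n f = ∑ t ∈ layerIdx d n, blockOp r t f := by
  have h1 : ∀ t ∈ layerIdx d n, blockOp r t f = trigPoly (layerSupp d n) fun k =>
      if (fun j => dyadicIdx (k j)) = t then (wBern d r k : ℂ) * fCoeff f k else 0 := by
    intro t ht
    refine trigPoly_congr_subset (vpSupp_subset_layerSupp ht) (fun k _ => ?_) fun k _ hk => ?_
    · simp only [funext_iff]
      split_ifs with h
      · rw [vpWeight_eq_one h]; simp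
      · simp
    · rw [if_neg]
      intro h
      exact hk (mem_vpSupp (funext_iff.1 h))
  rw [Finset.sum_congr rfl h1, ← trigPoly_sum]
  refine trigPoly_congr_subset (layer_subset_layerSupp hn) (fun k hk => ?_) fun k _ hk => ?_
  · rw [Finset.sum_ite_eq, if_pos]
    exact mem_layerIdx.2 ((mem_layer_iff hn).1 hk)
  · rw [Finset.sum_ite_eq, if_neg]
    intro h
    exact hk ((mem_layer_iff hn).2 (mem_layerIdx.1 h))

theorem vpOp_blockOp {d : ℕ} (r : ℝ) (t : Fin d → ℤ) (f : Torus d → ℂ) :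
    vpOp t (blockOp r t f) = blockOp r t f := by
  unfold vpOp
  conv_rhs => rw [blockOp]
  refine trigPoly_congr_subset subset_rfl (fun k hk => ?_) fun k hk hk' => absurd hk hk'
  rw [blockOp, fCoeff_trigPoly, if_pos hk]
  split_ifs with h
  · rw [vpWeight_eq_one h]; simp
  · simp

theorem vpOp_add {d : ℕ} (t : Fin d → ℤ) {f g : Torus d → ℂ} (hf : Integrable f)
    (hg : Integrable g) : vpOp t (fun x => f x + g x) = vpOp t f + vpOp t g := by
  simp only [vpOp, fCoeff_add hf hg, mul_add, trigPoly_add]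

theorem norm_sum_sq_le_card_mul {ι : Type*} (s : Finset ι) (f : ι → ℂ) :
    ‖∑ i ∈ s, f i‖ ^ 2 ≤ s.card * ∑ i ∈ s, ‖f i‖ ^ 2 :=
  (pow_le_pow_left₀ (norm_nonneg _) (norm_sum_le _ _) 2).trans (sq_sum_le_card_mul_sum_sq)

theorem exists_layer_decomp_of_bdd (d k : ℕ) (hd : 1 ≤ d) {r : ℝ} (hr : 0 ≤ r) :
    ∃ C : ℝ, 1 ≤ C ∧ ∀ n : ℕ, 1 ≤ n → ∀ (ψ : Torus d → ℂ) (u ε : ℝ), 0 ≤ u → 0 < ε →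
      MemLp ψ 2 → (∀ᵐ x, ‖ψ x‖ ≤ u) →
      ∃ (a : (Fin d → ℤ) → ℂ) (h : C(Torus d, ℂ)),
        layerOp r n ψ = trigPoly (layerSupp d n) a + h ∧
        ∑ k ∈ layerSupp d n, ‖a k‖ ^ 2 ≤ C * ((2 : ℝ) ^ (-(r * n))) ^ 2 *
          (u / ε) ^ (2 ^ (k + 1) - 2) * ∫ x, ‖ψ x‖ ^ 2 ∧
        ∀ x, ‖h x‖ ≤ C * (2 : ℝ) ^ (-(r * n)) * ε * n ^ (d - 1) := by
  obtain ⟨K, hK, hmult⟩ := exists_isMultBound_block d k hr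
  set q := 2 ^ (k + 1) with hq
  have hq2 : 2 ≤ q := by rw [hq, pow_succ]; have := Nat.one_le_two_pow (n := k); omega
  have hc := torusMass_pos d
  have h3 : (1 : ℝ) ≤ 3 ^ d := one_le_pow₀ (by norm_num)
  set C0 : ℝ := ((2 * π) ^ d)⁻¹ * 3 ^ d * K ^ q * (3 ^ d) ^ (q - 2) * 3 ^ d with hC0
  have hC0p : 0 < C0 := by positivity
  refine ⟨1 + C0 + 2 * 3 ^ d * 3 ^ d, by nlinarith, fun n hn ψ u ε hu hε hψ hψu => ?_⟩
  set ρ : ℝ := (2 : ℝ) ^ (-(r * n)) with hρ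
  have hρ0 : 0 < ρ := by positivity
  set g : (Fin d → ℤ) → C(Torus d, ℂ) := fun t => blockOp r t ψ with hg
  set S : (Fin d → ℤ) → Set (Torus d) := fun t => {x | ρ * ε < ‖g t x‖} with hS
  have hSm : ∀ t, MeasurableSet (S t) := fun t =>
    (isOpen_lt continuous_const (g t).continuous.norm).measurableSet
  set g0 : (Fin d → ℤ) → Torus d → ℂ := fun t => (S t).indicator (g t) with hg0
  set g1 : (Fin d → ℤ) → Torus d → ℂ := fun t => (S t)ᶜ.indicator (g t) with hg1
  have hg0L : ∀ t, MemLp (g0 t) 2 := fun t => (memLp_of_continuousMap 2 (g t)).indicator (hSm t)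
  have hg1L : ∀ t, MemLp (g1 t) 2 := fun t =>
    (memLp_of_continuousMap 2 (g t)).indicator (hSm t).compl
  have hg01 : ∀ t, (fun x => g0 t x + g1 t x) = g t := fun t =>
    Set.indicator_self_add_compl (S t) (g t)
  have hsplit : ∀ t, g t = vpOp t (g0 t) + vpOp t (g1 t) := by
    intro t
    rw [← vpOp_add t ((hg0L t).integrable one_le_two) ((hg1L t).integrable one_le_two), hg01,
      hg, vpOp_blockOp]
  set a : (Fin d → ℤ) → ℂ := fun k => ∑ t ∈ layerIdx d n,
    if k ∈ vpSupp t then (vpWeight t k : ℂ) * fCoeff (g0 t) k else 0 with ha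
  refine ⟨a, ∑ t ∈ layerIdx d n, vpOp t (g1 t), ?_, ?_, ?_⟩
  · rw [layerOp_eq_sum_blockOp hn, ha, trigPoly_sum, ← Finset.sum_add_distrib]
    refine Finset.sum_congr rfl fun t ht => ?_
    rw [← trigPoly_congr_subset (vpSupp_subset_layerSupp ht)
      (a := fun k => (vpWeight t k : ℂ) * fCoeff (g0 t) k) (fun k hk => by rw [if_pos hk])
      fun k _ hk => by rw [if_neg hk]]
    exact hsplit t
  · have hcoef : ∑ k ∈ layerSupp d n, ‖a k‖ ^ 2 ≤
        3 ^ d * ∑ t ∈ layerIdx d n, ∑ k ∈ vpSupp t, ‖fCoeff (g0 t) k‖ ^ 2 := by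
      have h1 : ∀ k ∈ layerSupp d n, ‖a k‖ ^ 2 ≤ 3 ^ d * ∑ t ∈ layerIdx d n,
          if k ∈ vpSupp t then ‖fCoeff (g0 t) k‖ ^ 2 else 0 := by
        intro k _
        simp only [ha, ← Finset.sum_filter]
        refine (norm_sum_sq_le_card_mul _ _).trans ?_
        refine mul_le_mul (by exact_mod_cast card_filter_vpSupp_le _ k)
          (Finset.sum_le_sum fun t _ => ?_) (by positivity) (by positivity)
        rw [norm_mul, Complex.norm_real, Real.norm_of_nonneg (vpWeight_nonneg _ _)]
        exact pow_le_pow_left₀ (mul_nonneg (vpWeight_nonneg t k) (norm_nonneg _))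
          (mul_le_of_le_one_left (norm_nonneg _) (vpWeight_le_one _ _)) 2
      refine (Finset.sum_le_sum h1).trans (le_of_eq ?_)
      rw [← Finset.mul_sum, Finset.sum_comm]
      congr 1
      refine Finset.sum_congr rfl fun t ht => ?_
      rw [← Finset.sum_filter]
      refine Finset.sum_congr ?_ fun _ _ => rfl
      ext k
      rw [Finset.mem_filter]
      exact ⟨fun h => h.2, fun h => ⟨vpSupp_subset_layerSupp ht h, h⟩⟩
    have hblock : ∀ t ∈ layerIdx d n, (2 * π) ^ d * ∑ k ∈ vpSupp t, ‖fCoeff (g0 t) k‖ ^ 2 ≤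
        K ^ q * (3 ^ d) ^ (q - 2) * ρ ^ 2 * (u / ε) ^ (q - 2) * ∫ x, ‖vpOp t ψ x‖ ^ 2 := by
      intro t ht
      have hpow : ∀ f : C(Torus d, ℂ), ∀ m : ℕ, Integrable fun x => ‖f x‖ ^ m := fun f m =>
        (f.continuous.norm.pow m).integrable_of_hasCompactSupport
          (HasCompactSupport.of_compactSpace _)
      have hcheb : ∫ x, ‖g0 t x‖ ^ 2 ≤ ((ρ * ε) ^ (q - 2))⁻¹ * ∫ x, ‖g t x‖ ^ q := by
        rw [← integral_const_mul]
        refine integral_mono_of_nonneg (Filter.Eventually.of_forall fun x => by positivity)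
          ((hpow (g t) q).const_mul _) (Filter.Eventually.of_forall fun x => ?_)
        simp only [hg0]
        by_cases hx : x ∈ S t
        · rw [Set.indicator_of_mem hx, ← div_eq_inv_mul, le_div_iff₀ (by positivity)]
          have hx' : ρ * ε < ‖g t x‖ := hx
          calc ‖g t x‖ ^ 2 * (ρ * ε) ^ (q - 2) ≤ ‖g t x‖ ^ 2 * ‖g t x‖ ^ (q - 2) := by gcongr
            _ = ‖g t x‖ ^ q := by rw [← pow_add]; congr 1; omega
        · rw [Set.indicator_of_notMem hx]
          simp only [norm_zero, ne_eq, OfNat.ofNat_ne_zero, not_false_eq_true, zero_pow]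
          positivity
      have hmul : lqNorm q (g t) ≤ K * ρ * lqNorm q (vpOp t ψ) := by
        have h1 := hmult t (vpSupp t) fun k => (vpWeight t k : ℂ) * fCoeff ψ k
        rw [mem_layerIdx.1 ht] at h1
        exact h1
      have hmulq : ∫ x, ‖g t x‖ ^ q ≤ (K * ρ) ^ q * ∫ x, ‖vpOp t ψ x‖ ^ q := by
        rw [← lqNorm_pow (by omega), ← lqNorm_pow (by omega), ← mul_pow]
        exact pow_le_pow_left₀ (lqNorm_nonneg _ _) hmul q
      have hsup : ∫ x, ‖vpOp t ψ x‖ ^ q ≤ (3 ^ d * u) ^ (q - 2) * ∫ x, ‖vpOp t ψ x‖ ^ 2 := by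
        rw [← integral_const_mul]
        refine integral_mono (hpow _ q) ((hpow _ 2).const_mul _) fun x => ?_
        calc ‖vpOp t ψ x‖ ^ q = ‖vpOp t ψ x‖ ^ (q - 2) * ‖vpOp t ψ x‖ ^ 2 := by
              rw [← pow_add]; congr 1; omega
          _ ≤ _ := by
              gcongr
              exact norm_vpOp_apply_le t (hψ.integrable one_le_two) hψu hu x
      calc (2 * π) ^ d * ∑ k ∈ vpSupp t, ‖fCoeff (g0 t) k‖ ^ 2 ≤ ∫ x, ‖g0 t x‖ ^ 2 :=
            sum_norm_fCoeff_sq_le _ (hg0L t)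
        _ ≤ ((ρ * ε) ^ (q - 2))⁻¹ * ((K * ρ) ^ q * ((3 ^ d * u) ^ (q - 2) *
              ∫ x, ‖vpOp t ψ x‖ ^ 2)) :=
            hcheb.trans (by gcongr; exact hmulq.trans (by gcongr))
        _ = _ := by
            obtain ⟨p, hp⟩ : ∃ p, q = p + 2 := ⟨q - 2, by omega⟩
            rw [hp, Nat.add_sub_cancel]
            simp only [mul_pow, div_pow, pow_add]
            field_simp
    have hsum : (2 * π) ^ d * ∑ t ∈ layerIdx d n, ∑ k ∈ vpSupp t, ‖fCoeff (g0 t) k‖ ^ 2 ≤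
        K ^ q * (3 ^ d) ^ (q - 2) * ρ ^ 2 * (u / ε) ^ (q - 2) * (3 ^ d * ∫ x, ‖ψ x‖ ^ 2) := by
      rw [Finset.mul_sum]
      refine (Finset.sum_le_sum hblock).trans ?_
      rw [← Finset.mul_sum]
      exact mul_le_mul_of_nonneg_left (sum_integral_norm_vpOp_sq_le hψ) (by positivity)
    have hI : 0 ≤ ∫ x, ‖ψ x‖ ^ 2 := integral_nonneg fun x => by positivity
    calc ∑ k ∈ layerSupp d n, ‖a k‖ ^ 2
        ≤ 3 ^ d * (((2 * π) ^ d)⁻¹ * ((2 * π) ^ d *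
          ∑ t ∈ layerIdx d n, ∑ k ∈ vpSupp t, ‖fCoeff (g0 t) k‖ ^ 2)) := by
          rw [inv_mul_cancel_left₀ hc.ne']; exact hcoef
      _ ≤ 3 ^ d * (((2 * π) ^ d)⁻¹ * (K ^ q * (3 ^ d) ^ (q - 2) * ρ ^ 2 * (u / ε) ^ (q - 2) *
          (3 ^ d * ∫ x, ‖ψ x‖ ^ 2))) := by gcongr
      _ = C0 * ρ ^ 2 * (u / ε) ^ (q - 2) * ∫ x, ‖ψ x‖ ^ 2 := by rw [hC0]; ring
      _ ≤ _ := by gcongr; nlinarith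
  · intro x
    rw [ContinuousMap.sum_apply]
    have h1 : ∀ t ∈ layerIdx d n, ‖vpOp t (g1 t) x‖ ≤ 3 ^ d * (ρ * ε) := fun t _ => by
      refine norm_vpOp_apply_le t ((hg1L t).integrable one_le_two)
        (Filter.Eventually.of_forall fun y => ?_) (by positivity) x
      simp only [hg1]
      by_cases hy : y ∈ S t
      · rw [Set.indicator_of_notMem (by simpa using hy), norm_zero]; positivity
      · rw [Set.indicator_of_mem (by simpa using hy)]
        exact not_lt.1 hy
    have hcard : ((layerIdx d n).card : ℝ) ≤ 2 * 3 ^ d * n ^ (d - 1) := by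
      exact_mod_cast card_layerIdx_le hd hn
    calc ‖∑ t ∈ layerIdx d n, vpOp t (g1 t) x‖ ≤ ∑ t ∈ layerIdx d n, 3 ^ d * (ρ * ε) :=
          norm_sum_le_of_le _ h1
      _ = (layerIdx d n).card * (3 ^ d * (ρ * ε)) := by rw [Finset.sum_const, nsmul_eq_mul]
      _ ≤ 2 * 3 ^ d * n ^ (d - 1) * (3 ^ d * (ρ * ε)) := by gcongr
      _ = (2 * 3 ^ d * 3 ^ d) * ρ * ε * n ^ (d - 1) := by ring
      _ ≤ _ := by gcongr; nlinarith

theorem wBern_nonneg (d : ℕ) (r : ℝ) (k : Fin d → ℤ) : 0 ≤ wBern d r k :=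
  Finset.prod_nonneg fun j _ => by split_ifs <;> positivity

theorem wBern_le_of_mem_layer {d n : ℕ} (hn : 1 ≤ n) {r : ℝ} (hr : 0 ≤ r) {k : Fin d → ℤ}
    (hk : k ∈ hypCross d n \ hypCross d (n - 1)) :
    wBern d r k ≤ (2 ^ r) ^ d * (2 : ℝ) ^ (-(r * n)) := by
  rw [mem_layer_iff hn] at hk
  have h2r : (1 : ℝ) ≤ 2 ^ r := one_le_rpow one_le_two hr
  have h1 : ∀ j ∈ Finset.univ, (if k j = 0 then 1 else |(k j : ℝ)| ^ (-r)) ≤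
      2 ^ r * (2 : ℝ) ^ (-(r * (dyadicIdx (k j)).natAbs)) := by
    intro j _
    split_ifs with h
    · simpa [h, dyadicIdx] using h2r
    · rw [natAbs_dyadicIdx]
      have hs : 0 < Nat.size (k j).natAbs := Nat.size_pos.2 (by omega)
      obtain ⟨s, hs⟩ : ∃ s, Nat.size (k j).natAbs = s + 1 := ⟨_, (Nat.sub_add_cancel hs).symm⟩
      have h2 : 2 ^ s ≤ (k j).natAbs := Nat.lt_size.1 (by omega)
      have h3 : ((2 : ℝ) ^ s) ≤ |(k j : ℝ)| := by
        rw [← Int.cast_abs, Int.abs_eq_natAbs]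
        exact_mod_cast h2
      calc |(k j : ℝ)| ^ (-r) ≤ ((2 : ℝ) ^ s) ^ (-r) :=
            rpow_le_rpow_of_nonpos (by positivity) h3 (by linarith)
        _ = _ := by
            rw [hs, ← rpow_natCast, ← rpow_mul two_pos.le, ← rpow_add two_pos]
            congr 1
            push_cast
            ring
  refine (Finset.prod_le_prod (fun j _ => by split_ifs <;> positivity) h1).trans (le_of_eq ?_)
  rw [Finset.prod_mul_distrib, Finset.prod_const, Finset.card_univ, Fintype.card_fin,
    ← rpow_sum_of_pos two_pos, ← hk]
  push_cast
  rw [Finset.mul_sum, Finset.sum_neg_distrib]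

theorem sqrt_sum_norm_add_sq_le {ι : Type*} (s : Finset ι) (a b : ι → ℂ) :
    √(∑ i ∈ s, ‖a i + b i‖ ^ 2) ≤ √(∑ i ∈ s, ‖a i‖ ^ 2) + √(∑ i ∈ s, ‖b i‖ ^ 2) := by
  have h := norm_add_le (WithLp.toLp 2 fun i : s => a i) (WithLp.toLp 2 fun i : s => b i)
  simp only [EuclideanSpace.norm_eq, PiLp.add_apply] at h
  simpa only [← Finset.sum_coe_sort s] using h

/-- `layerOp r n f` splits into a trigonometric polynomial with `ℓ₂`-norm of the coefficients at
most `A` and a function bounded by `B`. -/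
def HasLayerSplit {d : ℕ} (r : ℝ) (n : ℕ) (f : Torus d → ℂ) (A B : ℝ) : Prop :=
  ∃ (a : (Fin d → ℤ) → ℂ) (h : C(Torus d, ℂ)), layerOp r n f = trigPoly (layerSupp d n) a + h ∧
    √(∑ k ∈ layerSupp d n, ‖a k‖ ^ 2) ≤ A ∧ ∀ x, ‖h x‖ ≤ B

theorem HasLayerSplit.mono {d : ℕ} {r : ℝ} {n : ℕ} {f : Torus d → ℂ} {A B A' B' : ℝ}
    (h : HasLayerSplit r n f A B) (hA : A ≤ A') (hB : B ≤ B') : HasLayerSplit r n f A' B' := by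
  obtain ⟨a, g, h1, h2, h3⟩ := h
  exact ⟨a, g, h1, h2.trans hA, fun x => (h3 x).trans hB⟩

theorem HasLayerSplit.add {d : ℕ} {r : ℝ} {n : ℕ} {f f' : Torus d → ℂ} {A B A' B' : ℝ}
    (h : HasLayerSplit r n f A B) (h' : HasLayerSplit r n f' A' B') (hf : Integrable f)
    (hf' : Integrable f') : HasLayerSplit r n (fun x => f x + f' x) (A + A') (B + B') := by
  obtain ⟨a, g, h1, h2, h3⟩ := h
  obtain ⟨a', g', h1', h2', h3'⟩ := h'
  refine ⟨fun k => a k + a' k, g + g', ?_, (sqrt_sum_norm_add_sq_le _ _ _).trans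
    (add_le_add h2 h2'), fun x => (norm_add_le _ _).trans (add_le_add (h3 x) (h3' x))⟩
  have e : layerOp r n (fun x => f x + f' x) = layerOp r n f + layerOp r n f' := by
    simp only [layerOp, fCoeff_add hf hf', mul_add, trigPoly_add]
  rw [e, h1, h1', trigPoly_add]
  abel

theorem hasLayerSplit_of_memLp_two {d n : ℕ} (hn : 1 ≤ n) {r : ℝ} (hr : 0 ≤ r)
    {f : Torus d → ℂ} (hf : MemLp f 2) {I : ℝ} (hI : ∫ x, ‖f x‖ ^ 2 ≤ I ^ 2) (hI0 : 0 ≤ I) :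
    HasLayerSplit r n f ((2 ^ r) ^ d * (2 : ℝ) ^ (-(r * n)) * I) 0 := by
  set E := hypCross d n \ hypCross d (n - 1) with hE
  refine ⟨fun k => if k ∈ E then (wBern d r k : ℂ) * fCoeff f k else 0, 0, ?_, ?_, by simp⟩
  · rw [add_zero, layerOp]
    exact trigPoly_congr_subset (layer_subset_layerSupp hn) (fun k hk => by rw [if_pos hk])
      fun k _ hk => by rw [if_neg hk]
  · refine sqrt_le_iff.2 ⟨by positivity, ?_⟩
    have hb := sum_norm_fCoeff_sq_le (layerSupp d n) hf
    have h1 : (1 : ℝ) ≤ (2 * π) ^ d := one_le_pow₀ (by linarith [pi_gt_three])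
    have hb' : ∑ k ∈ layerSupp d n, ‖fCoeff f k‖ ^ 2 ≤ I ^ 2 := by
      have h0 : 0 ≤ ∑ k ∈ layerSupp d n, ‖fCoeff f k‖ ^ 2 :=
        Finset.sum_nonneg fun k _ => by positivity
      nlinarith
    calc _ ≤ ∑ k ∈ layerSupp d n, ((2 ^ r) ^ d * (2 : ℝ) ^ (-(r * n))) ^ 2 *
          ‖fCoeff f k‖ ^ 2 := by
          refine Finset.sum_le_sum fun k _ => ?_
          dsimp only
          split_ifs with hk
          · rw [norm_mul, mul_pow, Complex.norm_real, Real.norm_of_nonneg (wBern_nonneg d r k)]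
            gcongr
            · exact wBern_nonneg d r k
            · exact wBern_le_of_mem_layer hn hr hk
          · rw [norm_zero, zero_pow two_ne_zero]; positivity
      _ ≤ _ := by rw [← Finset.mul_sum, mul_pow _ I]; gcongr

theorem integral_norm_indicator_sq_le {d : ℕ} {φ : Torus d → ℂ} {p : ℝ} (hp : 2 ≤ p)
    (hφ : Integrable fun x => ‖φ x‖ ^ p) (hφ1 : ∫ x, ‖φ x‖ ^ p ≤ 1) {τ : ℝ} (hτ : 0 < τ)
    {S : Set (Torus d)} (hS : ∀ x ∈ S, τ < ‖φ x‖) :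
    ∫ x, ‖S.indicator φ x‖ ^ 2 ≤ τ ^ (2 - p) := by
  calc ∫ x, ‖S.indicator φ x‖ ^ 2 ≤ ∫ x, τ ^ (2 - p) * ‖φ x‖ ^ p := by
        refine integral_mono_of_nonneg (Filter.Eventually.of_forall fun x => by positivity)
          (hφ.const_mul _) (Filter.Eventually.of_forall fun x => ?_)
        simp only
        by_cases hx : x ∈ S
        · have h1 := hS x hx
          have h2 : 0 < ‖φ x‖ := hτ.trans h1
          rw [Set.indicator_of_mem hx]
          calc ‖φ x‖ ^ 2 = ‖φ x‖ ^ (2 - p) * ‖φ x‖ ^ p := by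
                rw [← rpow_add h2, ← rpow_natCast]; congr 1; push_cast; ring
            _ ≤ _ := by
                gcongr ?_ * _
                exact rpow_le_rpow_of_nonpos hτ h1.le (by linarith)
        · rw [Set.indicator_of_notMem hx]
          simp only [norm_zero, ne_eq, OfNat.ofNat_ne_zero, not_false_eq_true, zero_pow]
          positivity
    _ ≤ _ := by
        rw [integral_const_mul]
        exact mul_le_of_le_one_right (by positivity) hφ1

theorem geom_sum_le_inv {x : ℝ} (h0 : 0 ≤ x) (h1 : x < 1) (J : ℕ) :
    ∑ j ∈ Finset.range J, x ^ j ≤ (1 - x)⁻¹ := by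
  rw [← tsum_geometric_of_lt_one h0 h1]
  exact (summable_geometric_of_lt_one h0 h1).sum_le_tsum _ fun j _ => by positivity

theorem exists_level_ratio {p : ℝ} (hp : 2 ≤ p) : ∃ (k : ℕ) (η : ℝ), 0 < η ∧ η < 1 ∧
    2 ^ (p - 2) * (1 / (2 * η)) ^ (2 ^ (k + 1) - 2) < 1 := by
  obtain ⟨k, hk⟩ := pow_unbounded_of_one_lt p (one_lt_two (α := ℝ))
  set q : ℕ := 2 ^ (k + 1) with hq
  have hpq : p < q := by
    rw [hq, pow_succ]; push_cast; linarith
  have hq2 : 2 ≤ q := by rw [hq, pow_succ]; have := Nat.one_le_two_pow (n := k); omega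
  have hqR : (2 : ℝ) < q := by linarith
  have hq0 : (0 : ℝ) < q := by linarith
  refine ⟨k, 2 ^ ((p - q) / q), by positivity, ?_, ?_⟩
  · exact rpow_lt_one_of_one_lt_of_neg one_lt_two (div_neg_of_neg_of_pos (by linarith) hq0)
  · have e : (1 / (2 * (2 : ℝ) ^ ((p - q) / q))) = 2 ^ (-(1 + (p - q) / q)) := by
      rw [rpow_neg two_pos.le, rpow_add two_pos, rpow_one, one_div]
    rw [e, ← rpow_natCast, ← rpow_mul two_pos.le, ← rpow_add two_pos,
      Nat.cast_sub hq2]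
    refine rpow_lt_one_of_one_lt_of_neg one_lt_two ?_
    push_cast
    have : p - 2 + -(1 + (p - q) / q) * (q - 2) = 2 * ((p - q) / q) := by
      field_simp; ring
    rw [this]
    have := div_neg_of_neg_of_pos (show p - q < 0 by linarith) hq0
    linarith

/-- The dyadic layer operator applied to the unit ball of `L_p` splits, for every `l > 0`, into
a part controlled in `ℓ₂` and a part controlled in sup-norm. -/
theorem exists_hasLayerSplit (d : ℕ) (hd : 1 ≤ d) {p r : ℝ} (hp : 2 ≤ p) (hr : 0 ≤ r) :
    ∃ C : ℝ, 1 ≤ C ∧ ∀ n : ℕ, 1 ≤ n → ∀ φ : Torus d → ℂ, Measurable φ →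
      MemLp φ (ENNReal.ofReal p) → ∫ x, ‖φ x‖ ^ p ≤ 1 → ∀ l : ℝ, 0 < l →
      HasLayerSplit r n φ (C * (2 : ℝ) ^ (-(r * n)) * l ^ (1 - p / 2))
        (C * (2 : ℝ) ^ (-(r * n)) * (n ^ (d - 1) * l)) := by
  obtain ⟨k, η, hη0, hη1, hs1⟩ := exists_level_ratio hp
  obtain ⟨C1, hC1, hdec⟩ := exists_layer_decomp_of_bdd d k hd hr
  set q := 2 ^ (k + 1) with hq
  set s : ℝ := 2 ^ (p - 2) * (1 / (2 * η)) ^ (q - 2) with hs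
  have hs0 : 0 < s := by positivity
  have hss : √s < 1 := by rw [sqrt_lt' one_pos]; simpa using hs1
  set D : ℝ := √(C1 * 2 ^ (p - 2)) with hD
  set W : ℝ := (2 ^ r) ^ d with hW
  have hW1 : 1 ≤ W := one_le_pow₀ (one_le_rpow one_le_two hr)
  have hsi : 0 < (1 - √s)⁻¹ := inv_pos.2 (by linarith)
  have hηi : 0 < (1 - η)⁻¹ := inv_pos.2 (by linarith)
  have hD0 : 0 ≤ D := sqrt_nonneg _
  have hDs := mul_nonneg hD0 hsi.le
  have hCs := mul_nonneg (zero_le_one.trans hC1) hηi.le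
  refine ⟨2 * W + D * (1 - √s)⁻¹ + C1 * (1 - η)⁻¹, by linarith, fun n hn φ hφm hφ hφ1 l hl => ?_⟩
  set ρ : ℝ := (2 : ℝ) ^ (-(r * n)) with hρ
  have hρ0 : 0 < ρ := by positivity
  have hp0 : 0 < p := by linarith
  have hφI : Integrable fun x => ‖φ x‖ ^ p := by
    have := hφ.integrable_norm_rpow (by simpa using hp0) (by simp)
    simpa [ENNReal.toReal_ofReal hp0.le] using this
  have hφ2 : MemLp φ 2 := hφ.mono_exponent (by
    rw [← ENNReal.ofReal_ofNat]; exact ENNReal.ofReal_le_ofReal hp)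
  set T : ℕ → Set (Torus d) := fun J => {x | l * (1 / 2) ^ J < ‖φ x‖} with hT
  have hTm : ∀ J, MeasurableSet (T J) := fun J => measurableSet_lt measurable_const hφm.norm
  have hind : ∀ S : Set (Torus d), MeasurableSet S → MemLp (S.indicator φ) 2 := fun S hS =>
    hφ2.indicator hS
  have hlev : ∀ J, HasLayerSplit r n ((T J).indicator φ)
      (W * ρ * l ^ (1 - p / 2) + ∑ j ∈ Finset.range J, D * ρ * l ^ (1 - p / 2) * (√s) ^ j)
      (∑ j ∈ Finset.range J, C1 * ρ * (l * η ^ j) * n ^ (d - 1)) := by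
    intro J
    induction J with
    | zero =>
      refine (hasLayerSplit_of_memLp_two hn hr (I := l ^ (1 - p / 2)) (hind _ (hTm 0)) ?_
        (by positivity)).mono (by simp [hW, hρ]) (by simp)
      refine (integral_norm_indicator_sq_le hp hφI hφ1 hl (fun x hx => ?_)).trans (le_of_eq ?_)
      · simpa [hT] using hx
      · rw [← rpow_natCast, ← rpow_mul hl.le]; congr 1; push_cast; ring
    | succ J ih =>
      have hsub : T J ⊆ T (J + 1) := fun x hx => by
        simp only [hT, Set.mem_ofPred_eq] at hx ⊢
        refine lt_of_le_of_lt ?_ hx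
        rw [pow_succ]
        have : 0 < l * (1 / 2) ^ J := by positivity
        nlinarith
      have hUm : MeasurableSet (T (J + 1) \ T J) := (hTm _).diff (hTm _)
      have hU : HasLayerSplit r n ((T (J + 1) \ T J).indicator φ)
          (D * ρ * l ^ (1 - p / 2) * (√s) ^ J) (C1 * ρ * (l * η ^ J) * n ^ (d - 1)) := by
        obtain ⟨a, h, h1, h2, h3⟩ := hdec n hn ((T (J + 1) \ T J).indicator φ)
          (l * (1 / 2) ^ J) (l * η ^ J) (by positivity) (by positivity) (hind _ hUm)
          (Filter.Eventually.of_forall fun x => by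
            by_cases hx : x ∈ T (J + 1) \ T J
            · rw [Set.indicator_of_mem hx]
              exact not_lt.1 hx.2
            · rw [Set.indicator_of_notMem hx, norm_zero]; positivity)
        refine ⟨a, h, h1, ?_, h3⟩
        refine sqrt_le_iff.2 ⟨by positivity, h2.trans ?_⟩
        have h4 : ∫ x, ‖(T (J + 1) \ T J).indicator φ x‖ ^ 2 ≤ (l * (1 / 2) ^ (J + 1)) ^ (2 - p) :=
          integral_norm_indicator_sq_le hp hφI hφ1 (by positivity) fun x hx => hx.1
        have h5 : (l * (1 / 2) ^ (J + 1)) ^ (2 - p) =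
            (l ^ (1 - p / 2)) ^ 2 * (2 ^ (p - 2) * (2 ^ (p - 2)) ^ J) := by
          rw [mul_rpow hl.le (by positivity), ← pow_succ', ← rpow_natCast (l ^ _),
            ← rpow_mul hl.le, ← rpow_natCast (1 / 2), ← rpow_natCast (2 ^ (p - 2)),
            ← rpow_mul two_pos.le, one_div, inv_rpow two_pos.le, inv_rpow (by positivity),
            ← rpow_mul two_pos.le, ← rpow_neg two_pos.le]
          congr 2
          · push_cast; ring
          · ring
        have h6 : (l * (1 / 2) ^ J / (l * η ^ J)) = (1 / (2 * η)) ^ J := by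
          rw [mul_div_mul_left _ _ hl.ne', ← div_pow]
          congr 1
          field_simp
        rw [h6]
        calc C1 * ρ ^ 2 * ((1 / (2 * η)) ^ J) ^ (q - 2) *
              ∫ x, ‖(T (J + 1) \ T J).indicator φ x‖ ^ 2
            ≤ C1 * ρ ^ 2 * ((1 / (2 * η)) ^ J) ^ (q - 2) *
              ((l ^ (1 - p / 2)) ^ 2 * (2 ^ (p - 2) * (2 ^ (p - 2)) ^ J)) := by
              rw [← h5]; gcongr
          _ = _ := by
              rw [mul_pow _ (√s ^ J), ← pow_mul (√s), mul_comm J 2, pow_mul (√s), sq_sqrt hs0.le,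
                mul_pow _ (l ^ _), mul_pow D, hD, sq_sqrt (by positivity), hs, mul_pow,
                pow_right_comm]
              ring
      rw [Finset.sum_range_succ, Finset.sum_range_succ, ← add_assoc]
      have e : (T (J + 1)).indicator φ = fun x => (T J).indicator φ x +
          (T (J + 1) \ T J).indicator φ x := by
        rw [← Set.indicator_union_of_disjoint Set.disjoint_sdiff_right,
          Set.union_sdiff_cancel hsub]
      rw [e]
      exact ih.add hU ((hind _ (hTm J)).integrable one_le_two) ((hind _ hUm).integrable one_le_two)
  have hc := torusMass_pos d
  obtain ⟨J, hJ⟩ := exists_pow_lt_of_lt_one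
    (show 0 < l ^ (1 - p / 2) / (l * √((2 * π) ^ d)) by positivity) (one_half_lt_one (α := ℝ))
  rw [lt_div_iff₀ (by positivity)] at hJ
  have hrem : HasLayerSplit r n ((T J)ᶜ.indicator φ) (W * ρ * l ^ (1 - p / 2)) 0 := by
    refine hasLayerSplit_of_memLp_two hn hr (hind _ (hTm J).compl) ?_ (by positivity)
    have h1 : ∫ x, ‖(T J)ᶜ.indicator φ x‖ ^ 2 ≤ ∫ x : Torus d, (l * (1 / 2) ^ J) ^ 2 := by
      refine integral_mono_of_nonneg (Filter.Eventually.of_forall fun x => by positivity)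
        (integrable_const _) (Filter.Eventually.of_forall fun x => ?_)
      simp only
      by_cases hx : x ∈ T J
      · rw [Set.indicator_of_notMem (by simpa using hx)]
        simp only [norm_zero, ne_eq, OfNat.ofNat_ne_zero, not_false_eq_true, zero_pow]
        positivity
      · rw [Set.indicator_of_mem (by simpa using hx)]
        exact pow_le_pow_left₀ (norm_nonneg _) (not_lt.1 hx) 2
    refine h1.trans ?_
    rw [integral_const, volume_real_torus, smul_eq_mul]
    calc (2 * π) ^ d * (l * (1 / 2) ^ J) ^ 2 = ((1 / 2) ^ J * (l * √((2 * π) ^ d))) ^ 2 := by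
          rw [mul_pow l, mul_pow _ (l * _), mul_pow l, sq_sqrt hc.le]; ring
      _ ≤ _ := pow_le_pow_left₀ (by positivity) hJ.le 2
  have e : φ = fun x => (T J).indicator φ x + (T J)ᶜ.indicator φ x :=
    (Set.indicator_self_add_compl (T J) φ).symm
  rw [e]
  refine ((hlev J).add hrem ((hind _ (hTm J)).integrable one_le_two)
    ((hind _ (hTm J).compl).integrable one_le_two)).mono ?_ ?_
  · rw [← Finset.mul_sum]
    have h1 := geom_sum_le_inv (sqrt_nonneg s) hss J
    calc _ ≤ W * ρ * l ^ (1 - p / 2) + D * ρ * l ^ (1 - p / 2) * (1 - √s)⁻¹ +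
          W * ρ * l ^ (1 - p / 2) := by gcongr
      _ = (2 * W + D * (1 - √s)⁻¹ + 0) * ρ * l ^ (1 - p / 2) := by ring
      _ ≤ _ := by gcongr
  · rw [add_zero]
    have h1 := geom_sum_le_inv hη0.le hη1 J
    calc ∑ j ∈ Finset.range J, C1 * ρ * (l * η ^ j) * n ^ (d - 1)
        = C1 * ρ * l * n ^ (d - 1) * ∑ j ∈ Finset.range J, η ^ j := by
          rw [Finset.mul_sum]; exact Finset.sum_congr rfl fun j _ => by ring
      _ ≤ C1 * ρ * l * n ^ (d - 1) * (1 - η)⁻¹ := by gcongr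
      _ = (0 + C1 * (1 - η)⁻¹) * ρ * (n ^ (d - 1) * l) := by ring
      _ ≤ _ := by gcongr; positivity

theorem norm_fourier_sub_fourier_le (k : ℤ) (y z : ℝ) :
    ‖fourier k (y : AddCircle (2 * π)) - fourier k (z : AddCircle (2 * π))‖ ≤
      |(k : ℝ)| * |y - z| := by
  have h0 : (π : ℂ) ≠ 0 := by exact_mod_cast pi_ne_zero
  have e : ∀ w : ℝ, fourier k (w : AddCircle (2 * π)) = Complex.exp (Complex.I * (k * w : ℝ)) := by
    intro w
    rw [fourier_coe_apply]
    congr 1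
    push_cast
    field_simp
  have h1 : Complex.exp (Complex.I * (k * y : ℝ)) - Complex.exp (Complex.I * (k * z : ℝ)) =
      Complex.exp (Complex.I * (k * z : ℝ)) * (Complex.exp (Complex.I * (k * (y - z) : ℝ)) - 1) := by
    rw [mul_sub, ← Complex.exp_add, mul_one]
    congr 2
    push_cast
    ring
  rw [e, e, h1, norm_mul, mul_comm Complex.I, Complex.norm_exp_ofReal_mul_I, one_mul, ← abs_mul]
  exact norm_exp_I_mul_ofReal_sub_one_le

theorem norm_prod_sub_prod_le_sum {ι : Type*} (s : Finset ι) (f g : ι → ℂ) (hf : ∀ i, ‖f i‖ ≤ 1)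
    (hg : ∀ i, ‖g i‖ ≤ 1) : ‖∏ i ∈ s, f i - ∏ i ∈ s, g i‖ ≤ ∑ i ∈ s, ‖f i - g i‖ := by
  induction s using Finset.induction_on with
  | empty => simp
  | insert i s hi ih =>
    rw [Finset.prod_insert hi, Finset.prod_insert hi, Finset.sum_insert hi]
    have e : f i * ∏ j ∈ s, f j - g i * ∏ j ∈ s, g j =
        (f i - g i) * ∏ j ∈ s, f j + g i * (∏ j ∈ s, f j - ∏ j ∈ s, g j) := by ring
    rw [e]
    refine (norm_add_le _ _).trans ?_
    rw [norm_mul, norm_mul, norm_prod]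
    have h1 : ∏ j ∈ s, ‖f j‖ ≤ 1 := Finset.prod_le_one (fun j _ => norm_nonneg _) fun j _ => hf j
    exact add_le_add (mul_le_of_le_one_right (norm_nonneg _) h1)
      ((mul_le_of_le_one_left (norm_nonneg _) (hg i)).trans ih)

/-- The uniform grid with `N` points in each coordinate. -/
def gridPoint {d N : ℕ} (c : Fin d → Fin N) : Torus d := fun j =>
  ((2 * π * (c j : ℕ) / N : ℝ) : AddCircle (2 * π))

theorem exists_grid_near {N : ℕ} (hN : 0 < N) (x : AddCircle (2 * π)) :
    ∃ (y : ℝ) (c : Fin N), x = (y : AddCircle (2 * π)) ∧ |y - 2 * π * (c : ℕ) / N| ≤ 2 * π / N := by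
  have hNR : (0 : ℝ) < N := by exact_mod_cast hN
  have hpi : (0 : ℝ) < 2 * π := by positivity
  obtain ⟨y, hy, rfl⟩ : ∃ y ∈ Set.Ico (0 : ℝ) (2 * π), (y : AddCircle (2 * π)) = x := by
    refine ⟨AddCircle.equivIco (2 * π) 0 x, ?_, AddCircle.coe_equivIco⟩
    simpa using (AddCircle.equivIco (2 * π) 0 x).2
  have h0 : 0 ≤ y * N / (2 * π) := div_nonneg (mul_nonneg hy.1 hNR.le) hpi.le
  have h1 : ⌊y * N / (2 * π)⌋₊ < N := by
    rw [Nat.floor_lt h0, div_lt_iff₀ hpi, mul_comm]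
    exact mul_lt_mul_of_pos_left hy.2 hNR
  refine ⟨y, ⟨_, h1⟩, rfl, ?_⟩
  have h2 := Nat.floor_le h0
  have h3 := Nat.lt_floor_add_one (y * N / (2 * π))
  rw [le_div_iff₀ hpi] at h2
  rw [div_lt_iff₀ hpi] at h3
  have e : y - 2 * π * (⌊y * N / (2 * π)⌋₊ : ℕ) / N =
      (y * N - ⌊y * N / (2 * π)⌋₊ * (2 * π)) / N := by field_simp
  simp only
  rw [e, abs_of_nonneg (div_nonneg (by linarith) hNR.le)]
  gcongr
  linarith

theorem norm_trigChar_sub_gridPoint_le {d N : ℕ} (hN : 0 < N) (x : Torus d) :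
    ∃ c : Fin d → Fin N, ∀ (k : Fin d → ℤ) (K : ℝ), (∀ j, |(k j : ℝ)| ≤ K) →
      ‖trigChar k x - trigChar k (gridPoint c)‖ ≤ d * (K * (2 * π / N)) := by
  choose y c hy hc using fun j => exists_grid_near hN (x j)
  refine ⟨c, fun k K hK => ?_⟩
  have hn1 : ∀ (n : ℤ) (z : AddCircle (2 * π)), ‖fourier n z‖ ≤ 1 := fun n z => by
    rw [fourier_apply]; exact (Circle.norm_coe _).le
  refine (norm_prod_sub_prod_le_sum Finset.univ (fun j => fourier (k j) (x j))
    (fun j => fourier (k j) (gridPoint c j)) (fun j => hn1 _ _) fun j => hn1 _ _).trans ?_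
  have h1 : ∀ j ∈ Finset.univ, ‖fourier (k j) (x j) - fourier (k j) (gridPoint c j)‖ ≤
      K * (2 * π / N) := by
    intro j _
    have h2 := norm_fourier_sub_fourier_le (k j) (y j) (2 * π * (c j : ℕ) / N)
    rw [hy j, gridPoint]
    refine h2.trans (mul_le_mul (hK j) (hc j) (abs_nonneg _) ((abs_nonneg _).trans (hK j)))
  refine (Finset.sum_le_sum h1).trans (le_of_eq ?_)
  rw [Finset.sum_const, Finset.card_univ, Fintype.card_fin, nsmul_eq_mul]

theorem norm_coeff_le_of_norm_trigPoly_le {d : ℕ} {E : Finset (Fin d → ℤ)}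
    {a : (Fin d → ℤ) → ℂ} {M : ℝ} (hM : ∀ x, ‖trigPoly E a x‖ ≤ M) (hM0 : 0 ≤ M)
    {k : Fin d → ℤ} (hk : k ∈ E) : ‖a k‖ ≤ M := by
  have h1 := integral_norm_trigPoly_sq E a
  have hc := torusMass_pos d
  have h2 : ∫ x, ‖trigPoly E a x‖ ^ 2 ≤ ∫ _ : Torus d, M ^ 2 :=
    integral_mono_of_nonneg (Filter.Eventually.of_forall fun x => by positivity)
      (integrable_const _) (Filter.Eventually.of_forall fun x =>
        pow_le_pow_left₀ (norm_nonneg _) (hM x) 2)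
  rw [h1, integral_const, volume_real_torus, smul_eq_mul] at h2
  have h3 := le_of_mul_le_mul_left h2 hc
  have h4 := Finset.single_le_sum (f := fun k => ‖a k‖ ^ 2) (fun k _ => by positivity) hk
  exact le_of_sq_le_sq (h4.trans h3) hM0

theorem norm_trigPoly_le_two_mul_of_grid {d N : ℕ} (hN : 0 < N) {E : Finset (Fin d → ℤ)} {K : ℝ}
    (hK : ∀ k ∈ E, ∀ j, |(k j : ℝ)| ≤ K) (hEN : 2 * (E.card * (d * (K * (2 * π)))) ≤ N)
    (a : (Fin d → ℤ) → ℂ) {B : ℝ} (hB : ∀ c : Fin d → Fin N, ‖trigPoly E a (gridPoint c)‖ ≤ B)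
    (x : Torus d) : ‖trigPoly E a x‖ ≤ 2 * B := by
  have hNR : (0 : ℝ) < N := by exact_mod_cast hN
  obtain ⟨x0, -, hx0⟩ := isCompact_univ.exists_isMaxOn Set.univ_nonempty
    (trigPoly E a).continuous.norm.continuousOn
  have hmax : ∀ y, ‖trigPoly E a y‖ ≤ ‖trigPoly E a x0‖ := fun y => hx0 (Set.mem_univ y)
  refine (hmax x).trans ?_
  obtain ⟨c, hc⟩ := norm_trigChar_sub_gridPoint_le hN x0
  have h1 : ‖trigPoly E a x0 - trigPoly E a (gridPoint c)‖ ≤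
      E.card * (‖trigPoly E a x0‖ * (d * (K * (2 * π / N)))) := by
    rw [trigPoly_apply, trigPoly_apply, ← Finset.sum_sub_distrib, ← nsmul_eq_mul,
      ← Finset.sum_const]
    refine norm_sum_le_of_le _ fun k hk => ?_
    rw [← mul_sub, norm_mul]
    refine mul_le_mul ?_ (hc k K (hK k hk)) (norm_nonneg _) (norm_nonneg _)
    have h2 := norm_coeff_le_of_norm_trigPoly_le hmax (norm_nonneg _) hk
    rwa [trigPoly_apply] at h2
  have h2 : E.card * (‖trigPoly E a x0‖ * (d * (K * (2 * π / N)))) ≤ ‖trigPoly E a x0‖ / 2 := by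
    have e : E.card * (‖trigPoly E a x0‖ * (d * (K * (2 * π / N)))) =
        ‖trigPoly E a x0‖ / 2 * ((2 * (E.card * (d * (K * (2 * π))))) / N) := by
      field_simp
    rw [e]
    exact mul_le_of_le_one_right (by positivity) ((div_le_one hNR).2 hEN)
  have h3 := norm_le_norm_add_norm_sub' (trigPoly E a x0) (trigPoly E a (gridPoint c))
  have h4 := hB c
  linarith

/-- The number of grid points per coordinate used to discretize the sup-norm. -/
def gridSize (d n : ℕ) : ℕ := 28 * (2 * 12 ^ d * 2 ^ n * 2 ^ (n * d) * (d * 2 ^ (n + 1)))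

theorem gridSize_pos {d : ℕ} (hd : 1 ≤ d) (n : ℕ) : 0 < gridSize d n := by
  unfold gridSize; positivity

theorem norm_trigPoly_layerSupp_le {d n : ℕ} (hd : 1 ≤ d) (hn : 1 ≤ n)
    (a : (Fin d → ℤ) → ℂ) {B : ℝ} (hB : ∀ c : Fin d → Fin (gridSize d n),
      ‖trigPoly (layerSupp d n) a (gridPoint c)‖ ≤ B)
    (x : Torus d) : ‖trigPoly (layerSupp d n) a x‖ ≤ 2 * B := by
  refine norm_trigPoly_le_two_mul_of_grid (gridSize_pos hd n) (K := 2 ^ (n + 1))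
    (fun k hk j => ?_) ?_ a hB x
  · exact_mod_cast (abs_lt_of_mem_layerSupp hk j).le
  · have h1 : ((layerSupp d n).card : ℝ) ≤ 2 * 12 ^ d * 2 ^ n * 2 ^ (n * d) := by
      have h2 : n ^ (d - 1) ≤ 2 ^ (n * d) := by
        rw [pow_mul]
        exact (Nat.pow_le_pow_left Nat.lt_two_pow_self.le _).trans
          (Nat.pow_le_pow_right (by positivity) (Nat.sub_le _ _))
      exact_mod_cast (card_layerSupp_le hd hn).trans (Nat.mul_le_mul_left _ h2)
    have h7 : 2 * π ≤ 7 := by linarith [pi_lt_d2]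
    calc (2 * ((layerSupp d n).card * (d * (2 ^ (n + 1) * (2 * π)))) : ℝ)
        ≤ 2 * ((2 * 12 ^ d * 2 ^ n * 2 ^ (n * d)) * (d * (2 ^ (n + 1) * 7))) := by gcongr
      _ ≤ 28 * (2 * 12 ^ d * 2 ^ n * 2 ^ (n * d) * (d * 2 ^ (n + 1))) := by
          have : (0 : ℝ) ≤ 2 * 12 ^ d * 2 ^ n * 2 ^ (n * d) * (d * 2 ^ (n + 1)) := by positivity
          linarith
      _ = _ := by unfold gridSize; push_cast; ring

theorem exists_log_card_grid_le {d : ℕ} (hd : 1 ≤ d) : ∃ C : ℝ, 1 ≤ C ∧ ∀ n : ℕ, 1 ≤ n →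
    log (5 * (Fintype.card (Fin d → Fin (gridSize d n)) : ℕ)) ≤ C * n := by
  set G : ℝ := 28 * (2 * 12 ^ d * (d * 2)) with hG
  have hdR : (1 : ℝ) ≤ d := by exact_mod_cast hd
  have h12 : (1 : ℝ) ≤ 12 ^ d := one_le_pow₀ (by norm_num)
  have hG1 : 1 ≤ G := by rw [hG]; nlinarith
  have hlG := log_nonneg hG1
  have hl5 := log_nonneg (show (1 : ℝ) ≤ 5 by norm_num)
  have hl2 := log_nonneg (show (1 : ℝ) ≤ 2 by norm_num)
  refine ⟨1 + log 5 + d * log G + d * (d + 2) * log 2, by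
    have : 0 ≤ d * log G := by positivity
    have : 0 ≤ d * (d + 2) * log 2 := by positivity
    linarith, fun n hn => ?_⟩
  have hnR : (1 : ℝ) ≤ n := by exact_mod_cast hn
  have e : (gridSize d n : ℝ) = G * 2 ^ (n * (d + 2)) := by
    rw [hG, gridSize]; push_cast; ring
  rw [Fintype.card_fun, Fintype.card_fin, Fintype.card_fin]
  push_cast
  rw [log_mul (by norm_num) (by rw [e]; positivity), log_pow, e,
    log_mul (by positivity) (by positivity), log_pow]
  push_cast
  have h1 : 0 ≤ (n - 1 : ℝ) * (log 5 + d * log G) :=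
    mul_nonneg (by linarith) (by positivity)
  nlinarith

theorem dK_le_of_subspace {A B : Type*} [NormedAddCommGroup A] [NormedAddCommGroup B]
    [NormedSpace ℂ B] {T : A → B} {m : ℕ} {D : ℝ} (hD : 0 ≤ D) (L : Submodule ℂ B)
    (hL : FiniteDimensional ℂ L) (hLm : Module.finrank ℂ L < m)
    (h : ∀ a, ‖a‖ ≤ 1 → ∃ b ∈ L, ‖T a - b‖ ≤ D) : dK T m ≤ D := by
  have hnn : ∀ (M : Submodule ℂ B) (a : A), 0 ≤ ⨅ b : M, ‖T a - (b : B)‖ := fun M a =>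
    Real.iInf_nonneg fun b => norm_nonneg _
  refine (ciInf_le ⟨0, ?_⟩ (⟨L, hL, hLm⟩ :
    {L : Submodule ℂ B // FiniteDimensional ℂ L ∧ Module.finrank ℂ L < m})).trans ?_
  · rintro _ ⟨M, rfl⟩
    exact Real.iSup_nonneg fun a => hnn M.1 a.1
  · refine Real.iSup_le (fun a => ?_) hD
    obtain ⟨b, hb, hab⟩ := h a.1 a.2
    refine (ciInf_le ⟨0, ?_⟩ (⟨b, hb⟩ : L)).trans hab
    rintro _ ⟨b, rfl⟩
    exact norm_nonneg _

theorem toLinfty_sub {d : ℕ} (f g : C(Torus d, ℂ)) :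
    toLinfty (f - g) = toLinfty f - toLinfty g :=
  map_sub (ContinuousMap.toLp ∞ (volume : Measure (Torus d)) ℂ) f g

theorem norm_toLinfty_le {d : ℕ} {g : C(Torus d, ℂ)} {D : ℝ} (hD : 0 ≤ D)
    (h : ∀ x, ‖g x‖ ≤ D) : ‖toLinfty g‖ ≤ D := by
  have h1 : ∀ᵐ x, ‖toLinfty g x‖ ≤ D := by
    filter_upwards [ContinuousMap.coeFn_toLp (p := ∞) (𝕜 := ℂ) volume g] with x hx
    rw [toLinfty, hx]
    exact h x
  simpa using Lp.norm_le_of_ae_bound hD h1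

theorem exists_layer_subspace (d : ℕ) (hd : 1 ≤ d) : ∃ C : ℝ, 1 ≤ C ∧ ∀ n m : ℕ, 1 ≤ n → 1 ≤ m →
    ∃ L : Submodule ℂ (Lp ℂ ∞ (volume : Measure (Torus d))),
      FiniteDimensional ℂ L ∧ Module.finrank ℂ L < m ∧ ∀ a : (Fin d → ℤ) → ℂ,
        ∃ g : C(Torus d, ℂ), toLinfty g ∈ L ∧ ∀ x, ‖(trigPoly (layerSupp d n) a - g) x‖ ≤
          C * √(2 ^ n * n ^ d / m) * √(∑ k ∈ layerSupp d n, ‖a k‖ ^ 2) := by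
  obtain ⟨C, hC, hlog⟩ := exists_log_card_grid_le hd
  have h12 : (1 : ℝ) ≤ 12 ^ d := one_le_pow₀ (by norm_num)
  have hC1 : 1 ≤ √(2 * 12 ^ d * C) := one_le_sqrt.2 (by nlinarith)
  refine ⟨8000 * √(2 * 12 ^ d * C), by linarith, fun n m hn hm => ?_⟩
  have hmR : (0 : ℝ) < m := by exact_mod_cast hm
  have : Nonempty (Fin (gridSize d n)) := ⟨⟨0, gridSize_pos hd n⟩⟩
  obtain ⟨L, hLm, hL⟩ := exists_kolmogorov_subspace
    (fun (c : Fin d → Fin (gridSize d n)) (k : layerSupp d n) => trigChar k.1 (gridPoint c))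
    (fun c k => (norm_trigChar _ _).le) m hm
  set Φ : (layerSupp d n → ℂ) →ₗ[ℂ] Lp ℂ ∞ (volume : Measure (Torus d)) :=
    (ContinuousMap.toLp ∞ (volume : Measure (Torus d)) ℂ).toLinearMap ∘ₗ
      Fintype.linearCombination ℂ (fun k : layerSupp d n => trigChar k.1) with hΦ
  refine ⟨L.map Φ, inferInstance, (Submodule.finrank_map_le Φ L).trans_lt hLm, fun a => ?_⟩
  obtain ⟨b, hb, hab⟩ := hL fun k => a k.1
  set b' : (Fin d → ℤ) → ℂ := fun k => if h : k ∈ layerSupp d n then b ⟨k, h⟩ else 0 with hb'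
  have hbb : ∀ k : layerSupp d n, b' k.1 = b k := fun k => by rw [hb']; simp
  refine ⟨trigPoly (layerSupp d n) b', ⟨b, hb, ?_⟩, fun x => ?_⟩
  · rw [trigPoly, ← Finset.sum_coe_sort]
    simp only [hbb]
    rfl
  · have e : trigPoly (layerSupp d n) a - trigPoly (layerSupp d n) b' =
        trigPoly (layerSupp d n) fun k => a k - b' k := by
      simp only [trigPoly, sub_smul, Finset.sum_sub_distrib]
    rw [e]
    have h1 := norm_trigPoly_layerSupp_le hd hn (fun k => a k - b' k)
      (B := 4000 * √((layerSupp d n).card * log (5 * (Fintype.card (Fin d → Fin (gridSize d n)) :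
        ℕ)) / m) * √(∑ k ∈ layerSupp d n, ‖a k‖ ^ 2)) (fun c => by
        rw [trigPoly_apply, ← Finset.sum_coe_sort, ← Finset.sum_coe_sort (layerSupp d n)]
        simp only [hbb]
        simpa only [Fintype.card_coe] using hab c) x
    have hcard : ((layerSupp d n).card : ℝ) ≤ 2 * 12 ^ d * 2 ^ n * n ^ (d - 1) := by
      exact_mod_cast card_layerSupp_le hd hn
    have h2 : √((layerSupp d n).card * log (5 * (Fintype.card (Fin d → Fin (gridSize d n)) :
        ℕ)) / m) ≤ √(2 * 12 ^ d * C) * √(2 ^ n * n ^ d / m) := by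
      rw [← sqrt_mul (by positivity)]
      refine sqrt_le_sqrt ?_
      have hnd : (n : ℝ) ^ d = n ^ (d - 1) * n := by
        rw [← pow_succ, Nat.sub_add_cancel hd]
      calc _ ≤ (2 * 12 ^ d * 2 ^ n * n ^ (d - 1)) * (C * n) / (m : ℝ) := by
            gcongr
            · refine log_nonneg ?_
              have h3 : (1 : ℝ) ≤ (Fintype.card (Fin d → Fin (gridSize d n)) : ℕ) := by
                exact_mod_cast Fintype.card_pos
              linarith
            · exact hlog n hn
        _ = _ := by rw [hnd]; ring
    calc _ ≤ _ := h1
      _ ≤ 2 * (4000 * (√(2 * 12 ^ d * C) * √(2 ^ n * n ^ d / m)) *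
          √(∑ k ∈ layerSupp d n, ‖a k‖ ^ 2)) := by gcongr
      _ = _ := by ring

theorem integral_norm_rpow_le_one {d : ℕ} {p : ℝ} (hp : 0 < p)
    {φ : Lp ℂ (ENNReal.ofReal p) (volume : Measure (Torus d))} (hφ : ‖φ‖ ≤ 1) :
    ∫ x, ‖φ x‖ ^ p ≤ 1 := by
  have hI : 0 ≤ ∫ x, ‖φ x‖ ^ p := integral_nonneg fun x => by positivity
  rw [Lp.norm_def, (Lp.memLp φ).eLpNorm_eq_integral_rpow_norm (by simpa using hp) (by simp),
    ENNReal.toReal_ofReal hp.le, ENNReal.toReal_ofReal (by positivity)] at hφ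
  by_contra! h
  exact absurd hφ (not_le.2 (one_lt_rpow h (inv_pos.2 hp)))

/-- The balancing level, at which the two parts of the splitting contribute equally. -/
theorem exists_balanced_level {d n m : ℕ} (hd : 1 ≤ d) (hn : 1 ≤ n) (hm : 1 ≤ m) {p : ℝ}
    (hp : 0 < p) : ∃ l : ℝ, 0 < l ∧
      (n : ℝ) ^ (d - 1) * l = ((2 ^ n : ℝ) / m) ^ (1 / p) *
          (n : ℝ) ^ ((d - 1 : ℝ) * (1 - 1 / p) + 1 / p) ∧
      √(2 ^ n * n ^ d / m) * l ^ (1 - p / 2) = ((2 ^ n : ℝ) / m) ^ (1 / p) *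
          (n : ℝ) ^ ((d - 1 : ℝ) * (1 - 1 / p) + 1 / p) := by
  have hmR : (0 : ℝ) < m := by exact_mod_cast hm
  have hnR : (0 : ℝ) < n := by exact_mod_cast hn
  set X : ℝ := 2 ^ n / m with hX
  have hX0 : 0 < X := by positivity
  have hR : (2 : ℝ) ^ n * n ^ d / m = X * (n : ℝ) ^ (d : ℝ) := by
    rw [rpow_natCast, hX]; ring
  have hnd : (n : ℝ) ^ (d - 1) = (n : ℝ) ^ (d - 1 : ℝ) := by
    rw [← rpow_natCast, Nat.cast_sub hd, Nat.cast_one]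
  have hp0 := hp.ne'
  refine ⟨X ^ (1 / p) * (n : ℝ) ^ ((2 - d : ℝ) / p), by positivity, ?_, ?_⟩
  · rw [hnd, mul_left_comm, ← rpow_add hnR]
    congr 2
    field_simp
    ring
  · rw [hR, sqrt_eq_rpow, mul_rpow hX0.le (by positivity), mul_rpow (by positivity) (by positivity),
      ← rpow_mul hX0.le, ← rpow_mul hnR.le, ← rpow_mul hnR.le, mul_mul_mul_comm,
      ← rpow_add hX0, ← rpow_add hnR]
    congr 2
    · field_simp
      ring
    · field_simp
      ring

theorem stmt15 (d : ℕ) (hd : 1 ≤ d) (p r : ℝ) (hp : 2 ≤ p) (hr : 0 ≤ r) :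
    ∃ C : ℝ, 0 < C ∧ ∀ n : ℕ, 1 ≤ n → ∀ m : ℕ, 1 ≤ m → m ≤ (hypCross d n).card →
      dK (SDeltaW d r (ENNReal.ofReal p) n) m ≤
        C * (2 : ℝ) ^ (-(r * n)) * ((2 ^ n : ℝ) / m) ^ (1 / p) *
          (n : ℝ) ^ ((d - 1 : ℝ) * (1 - 1 / p) + 1 / p) := by
  obtain ⟨C1, hC1, hsplit⟩ := exists_hasLayerSplit d hd hp hr
  obtain ⟨C2, hC2, hspace⟩ := exists_layer_subspace d hd
  have hp0 : 0 < p := by linarith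
  refine ⟨C2 * C1 + C1, by positivity, fun n hn m hm _ => ?_⟩
  obtain ⟨L, hL, hLm, hLa⟩ := hspace n m hn hm
  obtain ⟨l, hl, h1, h2⟩ := exists_balanced_level (d := d) hd hn hm hp0
  have : Fact (1 ≤ ENNReal.ofReal p) := ⟨by
    rw [← ENNReal.ofReal_one]; exact ENNReal.ofReal_le_ofReal (by linarith)⟩
  refine dK_le_of_subspace (by positivity) L hL hLm fun φ hφ => ?_
  obtain ⟨a, h, e, ha, hh⟩ := hsplit n hn φ (Lp.stronglyMeasurable φ).measurable (Lp.memLp φ)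
    (integral_norm_rpow_le_one hp0 hφ) l hl
  obtain ⟨g, hg, hag⟩ := hLa a
  refine ⟨toLinfty g, hg, ?_⟩
  have e' : SDeltaW d r (ENNReal.ofReal p) n φ = toLinfty (layerOp r n φ) := rfl
  rw [e', ← toLinfty_sub, e]
  refine norm_toLinfty_le (by positivity) fun x => ?_
  rw [add_sub_right_comm, ContinuousMap.add_apply]
  calc _ ≤ ‖(trigPoly (layerSupp d n) a - g) x‖ + ‖h x‖ := norm_add_le _ _
    _ ≤ C2 * √(2 ^ n * n ^ d / m) * (C1 * (2 : ℝ) ^ (-(r * n)) * l ^ (1 - p / 2)) +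
        C1 * (2 : ℝ) ^ (-(r * n)) * (n ^ (d - 1) * l) := by
        refine add_le_add ((hag x).trans ?_) (hh x)
        gcongr
    _ = C2 * C1 * (2 : ℝ) ^ (-(r * n)) * (√(2 ^ n * n ^ d / m) * l ^ (1 - p / 2)) +
        C1 * (2 : ℝ) ^ (-(r * n)) * (n ^ (d - 1) * l) := by ring
    _ = _ := by rw [h1, h2]; ring

end
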